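/- (Compactness.) Let u be a radially symmetric solution with sup over t > 0 of the C^{k+1}_b([0,∞),ℝ^n)-norm of u(·,t) finite and sup over t > 0 of the C^{k−1}_b([0,∞),ℝ^n)-norm of u_t(·,t) finite. Let (r_p, t_p) be a sequence in [0,+∞)×(0,+∞) with r_p → +∞, and set u_p(r) = u(r_p + r, t_p), ũ_p(r) = u_t(r_p + r, t_p). Then, after passing to a subsequence, there exist u_∞ ∈ C^k_b(ℝ,ℝ^n) and ũ_∞ ∈ C^{k−2}_b(ℝ,ℝ^n) such that for every L > 0, the C^k([−L,L],ℝ^n)-norm of u_p − u_∞ and the C^{k−2}([−L,L],ℝ^n)-norm of ũ_p − ũ_∞ tend to 0 as p → +∞, and ũ_∞(r) = −∇V(u_∞(r)) + u_∞''(r) for all r ∈ ℝ. -/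

import Mathlib

open Filter Topology Set MeasureTheory

noncomputable section

local notation "⟪" x ", " y "⟫" => @inner ℝ _ _ x y

abbrev Euc (n : ℕ) : Type := EuclideanSpace ℝ (Fin n)

variable {n : ℕ}

/-- Spatial partial derivative `u_r`. -/
def ur (u : ℝ → ℝ → Euc n) (r t : ℝ) : Euc n := deriv (fun s => u s t) r

/-- Second spatial partial derivative `u_rr`. -/
def urr (u : ℝ → ℝ → Euc n) (r t : ℝ) : Euc n := deriv (fun s => ur u s t) r

/-- Time partial derivative `u_t`. -/
def ut (u : ℝ → ℝ → Euc n) (r t : ℝ) : Euc n := deriv (fun s => u r s) t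

/-- Hessian (second differential) of the potential. -/
def hess (V : Euc n → ℝ) (x : Euc n) : Euc n →L[ℝ] Euc n := fderiv ℝ (gradient V) x

/-- Coercivity hypothesis. -/
def HCoerc (V : Euc n → ℝ) : Prop :=
  ∃ ε > (0:ℝ), ∃ R : ℝ, ∀ x : Euc n, R ≤ ‖x‖ → ε * ‖x‖ ^ 2 ≤ ⟪x, gradient V x⟫

/-- The set of nondegenerate minimum points of `V`. -/
def MinSet (V : Euc n → ℝ) : Set (Euc n) :=
  {m | gradient V m = 0 ∧ ∀ v : Euc n, v ≠ 0 → 0 < ⟪v, hess V m v⟫}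

/-- Data of the constants `λ_min`, `λ_max`, `d_Esc` from the paper, together with their
spectral characterizations. -/
structure EscData (n : ℕ) (V : Euc n → ℝ) where
  lmin : ℝ
  lmax : ℝ
  dEsc : ℝ
  lmin_pos : 0 < lmin
  dEsc_pos : 0 < dEsc
  lower : ∀ m ∈ MinSet V, ∀ v : Euc n, lmin * ‖v‖ ^ 2 ≤ ⟪v, hess V m v⟫
  upper : ∀ m ∈ MinSet V, ∀ v : Euc n, ⟪v, hess V m v⟫ ≤ lmax * ‖v‖ ^ 2
  esc_lower : ∀ m ∈ MinSet V, ∀ x : Euc n, ‖x - m‖ ≤ dEsc →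
    ∀ v : Euc n, lmin / 2 * ‖v‖ ^ 2 ≤ ⟪v, hess V x v⟫
  esc_upper : ∀ m ∈ MinSet V, ∀ x : Euc n, ‖x - m‖ ≤ dEsc →
    ∀ v : Euc n, ⟪v, hess V x v⟫ ≤ 2 * lmax * ‖v‖ ^ 2

/-- Radially symmetric solution of `u_t = -∇V(u) + ((d-1)/r) u_r + u_rr` with Neumann
boundary condition at the origin. -/
structure IsRadialSolution (d : ℕ) (V : Euc n → ℝ) (u : ℝ → ℝ → Euc n) : Prop where
  diff_r : ∀ t > (0:ℝ), ∀ r : ℝ, DifferentiableAt ℝ (fun s => u s t) r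
  diff_rr : ∀ t > (0:ℝ), ∀ r : ℝ, DifferentiableAt ℝ (fun s => ur u s t) r
  cont_rr : ∀ t > (0:ℝ), Continuous fun r => urr u r t
  diff_t : ∀ t > (0:ℝ), ∀ r : ℝ, DifferentiableAt ℝ (fun s => u r s) t
  cont_t : ∀ r : ℝ, ContinuousOn (fun s => ut u r s) (Ioi 0)
  bounded : ∃ C : ℝ, ∀ r t : ℝ, 0 ≤ r → 0 < t →
    ‖u r t‖ + ‖ur u r t‖ + ‖urr u r t‖ + ‖ut u r t‖ ≤ C
  pde : ∀ r > (0:ℝ), ∀ t > (0:ℝ),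
    ut u r t = -gradient V (u r t) + (((d : ℝ) - 1) / r) • ur u r t + urr u r t
  neumann : ∀ t > (0:ℝ), ur u 0 t = 0

/-- Profiles of fronts travelling at speed `c` connecting `um` to `up`
(nonconstant solutions of `φ'' = -cφ' + ∇V(φ)`). -/
def Phi (V : Euc n → ℝ) (c : ℝ) (um up : Euc n) : Set (ℝ → Euc n) :=
  {φ | (∃ ξ₁ ξ₂ : ℝ, φ ξ₁ ≠ φ ξ₂) ∧
    (∀ ξ : ℝ, DifferentiableAt ℝ φ ξ) ∧ (∀ ξ : ℝ, DifferentiableAt ℝ (deriv φ) ξ) ∧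
    (∀ ξ : ℝ, deriv (deriv φ) ξ = -(c • deriv φ ξ) + gradient V (φ ξ)) ∧
    Tendsto φ atBot (𝓝 um) ∧ Tendsto φ atTop (𝓝 up)}

/-- Fronts travelling at speed `c` invading the equilibrium `mp`. -/
def PhiInv (V : Euc n → ℝ) (c : ℝ) (mp : Euc n) : Set (ℝ → Euc n) :=
  ⋃ mm ∈ MinSet V, Phi V c mm mp

/-- Normalized front profiles. -/
def PhiNorm (V : Euc n → ℝ) (dEsc c : ℝ) (mm mp : Euc n) : Set (ℝ → Euc n) :=
  {φ | φ ∈ Phi V c mm mp ∧ ‖φ 0 - mp‖ = dEsc ∧ ∀ ξ > (0:ℝ), ‖φ ξ - mp‖ < dEsc}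

/-- Normalized front profiles invading `mp`. -/
def PhiNormInv (V : Euc n → ℝ) (dEsc c : ℝ) (mp : Euc n) : Set (ℝ → Euc n) :=
  ⋃ mm ∈ MinSet V, PhiNorm V dEsc c mm mp

/-- Every critical point of `V` is nondegenerate. -/
def HNonDeg (V : Euc n → ℝ) : Prop :=
  ∀ x : Euc n, gradient V x = 0 → ∀ v : Euc n, hess V x v = 0 → v = 0

/-- Every front travelling at a positive speed and invading a minimum point is bistable. -/
def HOnlyBist (V : Euc n → ℝ) : Prop :=
  ∀ mp ∈ MinSet V, ∀ um : Euc n, gradient V um = 0 →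
    ∀ c > (0:ℝ), (Phi V c um mp).Nonempty → um ∈ MinSet V

/-- The set of invading speeds has empty interior. -/
def HDiscVel (V : Euc n → ℝ) : Prop :=
  ∀ mp ∈ MinSet V, interior {c : ℝ | 0 ≤ c ∧ (PhiInv V c mp).Nonempty} = ∅

/-- The set of initial values of normalized invading fronts is totally disconnected. -/
def HDiscFront (V : Euc n → ℝ) (dEsc : ℝ) : Prop :=
  ∀ mp ∈ MinSet V, ∀ c > (0:ℝ),
    IsTotallyDisconnected
      {p : Euc n × Euc n | ∃ φ ∈ PhiNormInv V dEsc c mp, p = (φ 0, deriv φ 0)}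

/-- The generic hypotheses on the potential. -/
def HGen (V : Euc n → ℝ) (dEsc : ℝ) : Prop :=
  HNonDeg V ∧ HOnlyBist V ∧ HDiscVel V ∧ HDiscFront V dEsc

/-- The solution is stable at infinity, close to the minimum point `m`. -/
def StableAtInfinity (V : Euc n → ℝ) (u : ℝ → ℝ → Euc n) (m : Euc n) : Prop :=
  m ∈ MinSet V ∧
    Tendsto (fun t => limsup (fun r => ‖u r t - m‖) atTop) atTop (𝓝 0)

/-- Propagating terrace of bistable fronts connecting `mLoc` to `mFar`. -/
def IsTerrace (V : Euc n → ℝ) (mLoc mFar : Euc n) (T : ℝ → ℝ → Euc n) : Prop :=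
  ∃ (q : ℕ) (ms : ℕ → Euc n) (cs : ℕ → ℝ) (φs : ℕ → ℝ → Euc n) (rs : ℕ → ℝ → ℝ),
    ms 0 = mFar ∧ ms q = mLoc ∧ (∀ i, i ≤ q → ms i ∈ MinSet V) ∧
    (∀ i, i < q → V (ms (i + 1)) < V (ms i)) ∧
    (∀ i, 1 ≤ i → i ≤ q → 0 < cs i) ∧
    (∀ i, 1 ≤ i → i + 1 ≤ q → cs (i + 1) ≤ cs i) ∧
    (∀ i, 1 ≤ i → i ≤ q → φs i ∈ Phi V (cs i) (ms i) (ms (i - 1))) ∧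
    (∀ i, 1 ≤ i → i ≤ q →
      (∀ t : ℝ, 0 ≤ t → 0 ≤ rs i t) ∧ (∀ t : ℝ, DifferentiableAt ℝ (rs i) t) ∧
        Tendsto (deriv (rs i)) atTop (𝓝 (cs i))) ∧
    (∀ i, 1 ≤ i → i + 1 ≤ q → Tendsto (fun t => rs (i + 1) t - rs i t) atTop atTop) ∧
    (∀ r t : ℝ, 0 ≤ r → 0 ≤ t →
      T r t = ms 0 + ∑ i ∈ Finset.Icc 1 q, (φs i (r - rs i t) - ms (i - 1)))

/-- Hypothesis `(H_hom)` unbundled: `u` is close to `m` on a growing interval around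
`rHom t`, travelling at asymptotic speed `cHom`; closeness is measured in `H¹` norm. -/
def HHomWith (u : ℝ → ℝ → Euc n) (m : Euc n) (cHom : ℝ) (rHom : ℝ → ℝ) : Prop :=
  0 < cHom ∧ (∀ t : ℝ, DifferentiableAt ℝ rHom t) ∧
    Tendsto (deriv rHom) atTop (𝓝 cHom) ∧
    ∀ L > (0:ℝ),
      Tendsto
        (fun t => ∫ r in (-L)..L,
          (‖u (rHom t + r) t - m‖ ^ 2 + ‖ur u (rHom t + r) t‖ ^ 2))
        atTop (𝓝 0)

/-- The set whose supremum defines the Escape point `r_Esc(t)`. -/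
def rEscSet (u : ℝ → ℝ → Euc n) (m : Euc n) (dEsc : ℝ) (rHom : ℝ → ℝ) (t : ℝ) : Set ℝ :=
  {r | r ∈ Icc 0 (rHom t) ∧ ‖u r t - m‖ = dEsc}

/-- The Escape point `r_Esc(t)`. -/
def rEscF (u : ℝ → ℝ → Euc n) (m : Euc n) (dEsc : ℝ) (rHom : ℝ → ℝ) (t : ℝ) : ℝ :=
  sSup (rEscSet u m dEsc rHom t)

/-- The upper limit mean speed `c_Esc` of the Escape point. -/
def cEscV (u : ℝ → ℝ → Euc n) (m : Euc n) (dEsc : ℝ) (rHom : ℝ → ℝ) : ℝ :=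
  limsup (fun t => rEscF u m dEsc rHom t / t) atTop

/-- `q_hull`: minimal convexity of the lower quadratic hulls of `V` at minimum points. -/
def qHull (V : Euc n → ℝ) : ℝ :=
  sInf {q : ℝ | ∃ m ∈ MinSet V, ∃ x : Euc n, x ≠ m ∧ q = (V x - V m) / ‖x - m‖ ^ 2}

/-- The weight `w` of the energy in the firewall functionals. -/
def wV (V : Euc n → ℝ) : ℝ := 1 / max 1 (-(4 * qHull V))

/-- The decay rate `κ₀`. -/
def kappa0 (lmin : ℝ) : ℝ := min (1 / 2) (lmin / 8)

/-- The "small curvature" radius `r_sc`. -/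
def rsc (d : ℕ) (lmin : ℝ) : ℝ := max (2 * ((d : ℝ) - 1)) (8 * ((d : ℝ) - 1) / lmin)

/-- The weight function `T_ρ ψ₀`. -/
def Tpsi (d : ℕ) (lmin : ℝ) (ρ r : ℝ) : ℝ :=
  if r ≤ rsc d lmin then Real.exp (-(kappa0 lmin) * |r - ρ|) * (r / rsc d lmin) ^ (d - 1)
  else Real.exp (-(kappa0 lmin) * |r - ρ|)

/-- The firewall functional `F₀` in the laboratory frame. -/
def F0 (V : Euc n → ℝ) (d : ℕ) (lmin : ℝ) (u : ℝ → ℝ → Euc n) (ρ t : ℝ) : ℝ :=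
  ∫ r in Ioi (0:ℝ),
    Tpsi d lmin ρ r * (wV V * (‖ur u r t‖ ^ 2 / 2 + V (u r t)) + ‖u r t‖ ^ 2 / 2)

/-- The set `Σ₀(t)` where the solution Escapes at distance `dEsc` from the origin. -/
def Sigma0 (u : ℝ → ℝ → Euc n) (dEsc t : ℝ) : Set ℝ := {r | 0 ≤ r ∧ dEsc < ‖u r t‖}

/-- The firewall differential inequality in the laboratory frame. -/
def FireIneq (V : Euc n → ℝ) (d : ℕ) (lmin dEsc : ℝ) (u : ℝ → ℝ → Euc n) (ν K : ℝ) : Prop :=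
  ∀ ρ ≥ rsc d lmin, ∀ t > (0:ℝ),
    DifferentiableAt ℝ (fun s => F0 V d lmin u ρ s) t ∧
    deriv (fun s => F0 V d lmin u ρ s) t ≤
      -ν * F0 V d lmin u ρ t + K * ∫ r in Sigma0 u dEsc t, Tpsi d lmin ρ r

/-- The quantity `δ = d_Esc √(min(w/2,1/4)/(κ₀+1))`. -/
def deltaEsc (dEsc w κ₀ : ℝ) : ℝ := dEsc * Real.sqrt (min (w / 2) (1 / 4) / (κ₀ + 1))

/-- The length `L₀`. -/
def L0c (κ₀ ν K δ : ℝ) : ℝ := κ₀⁻¹ * Real.log (16 * K / (ν * δ ^ 2 * κ₀))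

/-- The no-escape speed `c_noesc`. -/
def cNoEsc (κ₀ K L₀ δ : ℝ) : ℝ := 8 * K * L₀ / (κ₀ * δ ^ 2)

/-- The no-escape hull `h`. -/
def hull (δ L₀ : ℝ) (x : ℝ) : EReal :=
  if x < 0 then ⊤
  else if x ≤ L₀ then ((δ ^ 2 / 2 * (1 - x / (2 * L₀)) : ℝ) : EReal)
  else ((δ ^ 2 / 4 : ℝ) : EReal)

/-- The standing hypothesis that the firewall is below the two mirror hulls positioned
around `rHom t`. -/
def HullBound (V : Euc n → ℝ) (d : ℕ) (lmin : ℝ) (u : ℝ → ℝ → Euc n) (δ L₀ : ℝ)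
    (rHom : ℝ → ℝ) : Prop :=
  ∀ t ≥ (0:ℝ), rsc d lmin ≤ rHom t - 1 ∧
    ∀ r ≥ rsc d lmin, ((F0 V d lmin u r t : ℝ) : EReal) ≤
      max (hull δ L₀ (r - (rHom t - 1))) (hull δ L₀ (rHom t - r))

/-- The set whose infimum defines the escape point `r_esc(t)`. -/
def rescSet (V : Euc n → ℝ) (d : ℕ) (lmin : ℝ) (u : ℝ → ℝ → Euc n) (δ L₀ : ℝ)
    (rHom : ℝ → ℝ) (t : ℝ) : Set ℝ :=
  {rl | rl ∈ Icc (rsc d lmin) (rHom t) ∧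
    ∀ r ≥ rsc d lmin, ((F0 V d lmin u r t : ℝ) : EReal) ≤
      max (hull δ L₀ (r - rl)) (hull δ L₀ (rHom t - r))}

/-- The escape point `r_esc(t)`. -/
def rescF (V : Euc n → ℝ) (d : ℕ) (lmin : ℝ) (u : ℝ → ℝ → Euc n) (δ L₀ : ℝ)
    (rHom : ℝ → ℝ) (t : ℝ) : ℝ :=
  sInf (rescSet V d lmin u δ L₀ rHom t)

/-- `c̄`: upper limit of mean variations of a function over time intervals of length `s`. -/
def cbarF (f : ℝ → ℝ) : ℝ :=
  limsup (fun s => sSup {x : ℝ | ∃ t ≥ (0:ℝ), x = f (t + s) - f t} / s) atTop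

/-- `c̲`: lower limit of mean variations of a function over time intervals of length `s`. -/
def cunderF (f : ℝ → ℝ) : ℝ :=
  liminf (fun s => sInf {x : ℝ | ∃ t ≥ (0:ℝ), x = f (t + s) - f t} / s) atTop

/-- The decay rate `κ` in the travelling frame. -/
def kappaTF (lmin cno : ℝ) : ℝ := min (1 / 4) (lmin / (16 * (cno + 1)))

/-- The cut-off speed `c_cut` in the travelling frame. -/
def ccutTF (lmin lmax cno : ℝ) : ℝ := min (lmin / (8 * lmax)) (lmin / (8 * (cno + 1)))

/-- The energy weight `w'` in the travelling frame. -/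
def wTF (V : Euc n → ℝ) (cno : ℝ) : ℝ := min (wV V) (1 / (cno + 1) ^ 2)

/-- The weight function `χ` of the localized energy in the travelling frame. -/
def chiTF (d : ℕ) (lmin lmax cno c xcut r0 : ℝ) (ρ s : ℝ) : ℝ :=
  if ρ ≤ -r0 - c * s + rsc d lmin then
    Real.exp (c * ρ) * ((r0 + c * s + ρ) / rsc d lmin) ^ (d - 1)
  else if ρ ≤ xcut + ccutTF lmin lmax cno * s then Real.exp (c * ρ)
  else
    Real.exp ((c + kappaTF lmin cno) * (xcut + ccutTF lmin lmax cno * s) -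
      kappaTF lmin cno * ρ)

/-- The weight function `ψ` of the firewall in the travelling frame. -/
def psiTF (d : ℕ) (lmin lmax cno c xcut r0 : ℝ) (ρ s : ℝ) : ℝ :=
  if ρ ≤ -r0 - c * s + rsc d lmin then
    Real.exp ((c + kappaTF lmin cno) * ρ -
        kappaTF lmin cno * (xcut + ccutTF lmin lmax cno * s)) *
      ((r0 + c * s + ρ) / rsc d lmin) ^ (d - 1)
  else if ρ ≤ xcut + ccutTF lmin lmax cno * s then
    Real.exp ((c + kappaTF lmin cno) * ρ -
      kappaTF lmin cno * (xcut + ccutTF lmin lmax cno * s))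
  else
    Real.exp ((c + kappaTF lmin cno) * (xcut + ccutTF lmin lmax cno * s) -
      kappaTF lmin cno * ρ)

/-- The firewall functional `F(s)` in the travelling frame. -/
def FTF (V : Euc n → ℝ) (d : ℕ) (lmin lmax cno : ℝ) (u : ℝ → ℝ → Euc n)
    (t0 c xcut r0 : ℝ) (s : ℝ) : ℝ :=
  ∫ ρ in Ioi (-r0 - c * s),
    psiTF d lmin lmax cno c xcut r0 ρ s *
      (wTF V cno *
          (‖ur u (r0 + c * s + ρ) (t0 + s)‖ ^ 2 / 2 + V (u (r0 + c * s + ρ) (t0 + s))) +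
        ‖u (r0 + c * s + ρ) (t0 + s)‖ ^ 2 / 2)

/-- The set `Σ(s)` where the solution Escapes, in the travelling frame. -/
def SigmaTF (u : ℝ → ℝ → Euc n) (d : ℕ) (lmin dEsc : ℝ) (t0 c r0 : ℝ) (s : ℝ) : Set ℝ :=
  {ρ | -r0 - c * s + rsc d lmin ≤ ρ ∧ dEsc < ‖u (r0 + c * s + ρ) (t0 + s)‖}

/-- The weight function `ψ̃` in the standing frame. -/
def psiSF (d : ℕ) (κ cm cp : ℝ) (r t : ℝ) : ℝ :=
  if r ≤ cm * t then r ^ (d - 1) * Real.exp (-κ * (cm * t - r))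
  else if r ≤ cp * t then r ^ (d - 1)
  else r ^ (d - 1) * Real.exp (-κ * (r - cp * t))

/-- The firewall functional `F̃` in the standing frame. -/
def FSF (V : Euc n → ℝ) (d : ℕ) (κ cm cp : ℝ) (u : ℝ → ℝ → Euc n) (t : ℝ) : ℝ :=
  ∫ r in Ioi (0:ℝ),
    psiSF d κ cm cp r t * (wV V * (‖ur u r t‖ ^ 2 / 2 + V (u r t)) + ‖u r t‖ ^ 2 / 2)

/-- The quantity `δ_dissip(t)` measuring the dissipation around the escape point. -/
def deltaDissip (u : ℝ → ℝ → Euc n) (re : ℝ → ℝ) (cesc : ℝ) (t : ℝ) : ℝ :=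
  sInf {ε : ℝ | 0 < ε ∧
    (∫ τ in (-1:ℝ)..1, ∫ ρ in (-(1/ε))..(1/ε),
      ‖ut u (re (t + τ) + ρ) (t + τ) + cesc • ur u (re (t + τ) + ρ) (t + τ)‖ ^ 2) ≤ ε}

/-- `u` solves the radially symmetric system with initial datum `u₀`, in the sense of the
semi-flow on bounded continuous functions (classical for positive times). -/
def SolvesWithInit (d : ℕ) (V : Euc n → ℝ) (u : ℝ → ℝ → Euc n) (u₀ : ℝ → Euc n) : Prop :=
  (∀ r : ℝ, 0 ≤ r → u r 0 = u₀ r) ∧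
  (∀ t : ℝ, 0 ≤ t → ContinuousOn (fun r => u r t) (Ici 0) ∧ ∃ C, ∀ r : ℝ, 0 ≤ r → ‖u r t‖ ≤ C) ∧
  (∀ t : ℝ, 0 ≤ t → ∀ ε > (0:ℝ), ∃ δ > (0:ℝ), ∀ t' : ℝ, 0 ≤ t' → |t' - t| ≤ δ →
    ∀ r : ℝ, 0 ≤ r → ‖u r t' - u r t‖ ≤ ε) ∧
  (∀ t > (0:ℝ), ∀ r > (0:ℝ),
    DifferentiableAt ℝ (fun s => u s t) r ∧ DifferentiableAt ℝ (fun s => ur u s t) r) ∧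
  (∀ t > (0:ℝ), ∀ r : ℝ, 0 ≤ r → DifferentiableAt ℝ (fun s => u r s) t) ∧
  (∀ t > (0:ℝ), ∀ r > (0:ℝ),
    ut u r t = -gradient V (u r t) + (((d : ℝ) - 1) / r) • ur u r t + urr u r t) ∧
  (∀ t > (0:ℝ), DifferentiableAt ℝ (fun s => u s t) 0 ∧ ur u 0 t = 0)

/-- Arzelà–Ascoli for uniformly bounded and uniformly Lipschitz sequences on the line. -/
lemma exists_subseq_tendstoUniformlyOn_of_lipschitz {F : Type*} [NormedAddCommGroup F]
    [ProperSpace F] (g : ℕ → ℝ → F) (K : NNReal) (C : ℝ)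
    (hK : ∀ p, LipschitzWith K (g p)) (hC : ∀ p x, ‖g p x‖ ≤ C) :
    ∃ σ : ℕ → ℕ, StrictMono σ ∧ ∃ G : ℝ → F,
      ∀ L : ℝ, TendstoUniformlyOn (fun p => g (σ p)) G atTop (Icc (-L) L) := by
  let S : Set C(ℝ, F) := {f | LipschitzWith K f ∧ ∀ x, ‖f x‖ ≤ C}
  have hS : IsCompact S := by
    apply ArzelaAscoli.isCompact_of_equicontinuous
    · have himg : ContinuousMap.toFun '' S =
          {f : ℝ → F | LipschitzWith K f} ∩ (Set.univ.pi fun _ => Metric.closedBall 0 C) := by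
        ext f
        constructor
        · rintro ⟨f, hf, rfl⟩
          exact ⟨hf.1, fun x _ => by simpa using hf.2 x⟩
        · rintro ⟨h1, h2⟩
          exact ⟨⟨f, h1.continuous⟩, ⟨h1, fun x => by simpa using h2 x (mem_univ x)⟩, rfl⟩
      rw [himg]
      apply IsCompact.inter_left
      · exact isCompact_univ_pi fun _ => isCompact_closedBall _ _
      · simp only [lipschitzWith_iff_dist_le_mul, ofPred_forall]
        refine isClosed_iInter fun x => isClosed_iInter fun y => ?_
        exact isClosed_le (by fun_prop) (by fun_prop)
    · exact (LipschitzWith.uniformEquicontinuous _ K fun f => f.2.1).equicontinuous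
  obtain ⟨G, -, σ, hσ, hG⟩ := hS.tendsto_subseq
    (x := fun p => (⟨g p, (hK p).continuous⟩ : C(ℝ, F))) (fun p => ⟨hK p, hC p⟩)
  refine ⟨σ, hσ, G, fun L => ?_⟩
  exact ContinuousMap.tendsto_iff_forall_isCompact_tendstoUniformlyOn.1 hG _ isCompact_Icc

section BddLip
variable {F : Type*} [NormedAddCommGroup F] [NormedSpace ℝ F]

/-- `φ` is of class `C^m` on the half line, with derivatives bounded by `C`, the last of which is
`C`-Lipschitz. -/
def BddLip (m : ℕ) (C : ℝ) (φ : ℝ → F) : Prop :=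
  ContDiffOn ℝ m φ (Ioi 0) ∧ (∀ j ≤ m, ∀ x > (0:ℝ), ‖iteratedDeriv j φ x‖ ≤ C) ∧
    ∀ x > (0:ℝ), ∀ y > (0:ℝ), ‖iteratedDeriv m φ x - iteratedDeriv m φ y‖ ≤ C * |x - y|

lemma ContDiffOn.hasDerivAt_iteratedDeriv_of_isOpen {m j : ℕ} {φ : ℝ → F} {U : Set ℝ}
    (hφ : ContDiffOn ℝ m φ U) (hU : IsOpen U) (hj : j < m) {x : ℝ} (hx : x ∈ U) :
    HasDerivAt (iteratedDeriv j φ) (iteratedDeriv (j + 1) φ x) x := by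
  rw [iteratedDeriv_succ]
  apply DifferentiableAt.hasDerivAt
  have h := hφ.differentiableOn_iteratedDerivWithin (m := j) (by exact_mod_cast hj) hU.uniqueDiffOn
  have h2 : DifferentiableOn ℝ (iteratedDeriv j φ) U :=
    h.congr fun y hy => (iteratedDerivWithin_of_isOpen hU hy).symm
  exact (h2 x hx).differentiableAt (hU.mem_nhds hx)

lemma ContDiffOn.continuousOn_iteratedDeriv_of_isOpen {m j : ℕ} {φ : ℝ → F} {U : Set ℝ}
    (hφ : ContDiffOn ℝ m φ U) (hU : IsOpen U) (hj : j ≤ m) :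
    ContinuousOn (iteratedDeriv j φ) U :=
  (hφ.continuousOn_iteratedDerivWithin (by exact_mod_cast hj) hU.uniqueDiffOn).congr
    fun _ hy => (iteratedDerivWithin_of_isOpen hU hy).symm

/-- A function with `m` successive derivatives on an open set, the last one being continuous,
is of class `C^m` there. -/
lemma contDiffOn_of_hasDerivAt_chain {m : ℕ} {ψ : ℕ → ℝ → F} {U : Set ℝ} (hU : IsOpen U)
    (hd : ∀ j < m, ∀ x ∈ U, HasDerivAt (ψ j) (ψ (j + 1) x) x) (hc : ContinuousOn (ψ m) U) :
    ContDiffOn ℝ m (ψ 0) U ∧ ∀ j ≤ m, ∀ x ∈ U, iteratedDeriv j (ψ 0) x = ψ j x := by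
  have key : ∀ j ≤ m, ∀ x ∈ U, iteratedDeriv j (ψ 0) x = ψ j x := by
    intro j
    induction j with
    | zero => intro _ x _; simp
    | succ j ih =>
      intro hj x hx
      rw [iteratedDeriv_succ, ← (hd j hj x hx).deriv]
      apply Filter.EventuallyEq.deriv_eq
      filter_upwards [hU.mem_nhds hx] with y hy using ih (by omega) y hy
  refine ⟨?_, key⟩
  rw [contDiffOn_nat_iff_continuousOn_differentiableOn_deriv hU.uniqueDiffOn]
  have key2 : ∀ j ≤ m, ∀ x ∈ U, iteratedDerivWithin j (ψ 0) U x = ψ j x := fun j hj x hx => by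
    rw [iteratedDerivWithin_of_isOpen hU hx, key j hj x hx]
  constructor
  · intro j hj
    refine ContinuousOn.congr ?_ (key2 j hj)
    rcases hj.eq_or_lt with rfl | h
    · exact hc
    · exact fun x hx => (hd j h x hx).continuousAt.continuousWithinAt
  · intro j hj
    refine DifferentiableOn.congr ?_ (key2 j hj.le)
    exact fun x hx => (hd j hj x hx).differentiableAt.differentiableWithinAt

lemma BddLip.lip {m : ℕ} {C : ℝ} {φ : ℝ → F} (h : BddLip m C φ) {j : ℕ} (hj : j ≤ m) {x y : ℝ}
    (hx : 0 < x) (hy : 0 < y) :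
    ‖iteratedDeriv j φ x - iteratedDeriv j φ y‖ ≤ C * |x - y| := by
  rcases hj.eq_or_lt with rfl | hj'
  · exact h.2.2 x hx y hy
  · have := (convex_Ioi (0:ℝ)).norm_image_sub_le_of_norm_hasDerivWithin_le (C := C)
      (f := iteratedDeriv j φ) (f' := iteratedDeriv (j+1) φ) (x := y) (y := x)
      (fun z hz => (h.1.hasDerivAt_iteratedDeriv_of_isOpen isOpen_Ioi hj' hz).hasDerivWithinAt)
      (fun z hz => h.2.1 _ hj' z hz) hy hx
    simpa using this

/-- Successive derivatives pass to the limit under uniform convergence on an open set. -/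
lemma contDiffOn_of_tendstoUniformlyOn_iteratedDeriv {m : ℕ} {f : ℕ → ℝ → F} {ψ : ℕ → ℝ → F}
    {U : Set ℝ} (hU : IsOpen U) (hf : ∀ᶠ p in atTop, ContDiffOn ℝ m (f p) U)
    (hψ : ∀ j ≤ m, TendstoUniformlyOn (fun p => iteratedDeriv j (f p)) (ψ j) atTop U) :
    ContDiffOn ℝ m (ψ 0) U ∧ ∀ j ≤ m, ∀ x ∈ U, iteratedDeriv j (ψ 0) x = ψ j x := by
  apply contDiffOn_of_hasDerivAt_chain hU
  · intro j hj x hx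
    refine hasDerivAt_of_tendstoUniformlyOn hU (hψ (j+1) hj) ?_
      (fun x hx => (hψ j hj.le).tendsto_at hx) hx
    filter_upwards [hf] with p hp y hy
    exact hp.hasDerivAt_iteratedDeriv_of_isOpen hU hj hy
  · refine (hψ m le_rfl).continuousOn ?_
    refine Eventually.frequently ?_
    filter_upwards [hf] with p hp
    exact hp.continuousOn_iteratedDeriv_of_isOpen hU le_rfl

/-- Simultaneous extraction for all derivatives, with translations `ρ p` and cutoff at `δ`. -/
lemma BddLip.exists_subseq [ProperSpace F] {m : ℕ} {C : ℝ} (φ : ℕ → ℝ → F)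
    (h : ∀ p, BddLip m C (φ p)) (ρ : ℕ → ℝ) {δ : ℝ} (hδ : 0 < δ) :
    ∃ σ : ℕ → ℕ, StrictMono σ ∧ ∃ ψ : ℕ → ℝ → F, ∀ j ≤ m, ∀ L : ℝ,
      TendstoUniformlyOn (fun p x => iteratedDeriv j (φ (σ p)) (max (ρ (σ p) + x) δ)) (ψ j)
        atTop (Icc (-L) L) := by
  have hC : 0 ≤ C := (norm_nonneg _).trans ((h 0).2.1 0 (Nat.zero_le _) 1 one_pos)
  have hpos : ∀ y : ℝ, 0 < max y δ := fun y => hδ.trans_le (le_max_right _ _)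
  have hlip : ∀ p, LipschitzWith ⟨C, hC⟩
      (fun x (j : Fin (m + 1)) => iteratedDeriv j (φ p) (max (ρ p + x) δ)) := by
    intro p
    refine LipschitzWith.of_dist_le_mul fun x y => ?_
    rw [dist_pi_le_iff (by positivity)]
    intro j
    rw [dist_eq_norm]
    refine ((h p).lip (Nat.lt_succ_iff.1 j.2) (hpos _) (hpos _)).trans ?_
    rw [Real.dist_eq]
    refine mul_le_mul_of_nonneg_left ?_ hC
    refine (abs_max_sub_max_le_abs _ _ _).trans ?_
    simp
  obtain ⟨σ, hσ, G, hG⟩ := exists_subseq_tendstoUniformlyOn_of_lipschitz _ _ C hlip fun p x => by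
    rw [pi_norm_le_iff_of_nonneg hC]
    exact fun j => (h p).2.1 j (Nat.lt_succ_iff.1 j.2) _ (hpos _)
  refine ⟨σ, hσ, fun j x => if hj : j < m + 1 then G x ⟨j, hj⟩ else 0, fun j hj L => ?_⟩
  have hj' : j < m + 1 := by omega
  simp only [hj', dif_pos]
  rw [Metric.tendstoUniformlyOn_iff]
  intro ε hε
  filter_upwards [Metric.tendstoUniformlyOn_iff.1 (hG L) ε hε] with p hp x hx
  exact (dist_le_pi_dist (G x) _ ⟨j, hj'⟩).trans_lt (hp x hx)

/-- `BddLip` is closed under pointwise convergence. -/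
lemma BddLip.of_tendsto [ProperSpace F] {m : ℕ} {C : ℝ} {φ : ℕ → ℝ → F} {Φ : ℝ → F}
    (h : ∀ p, BddLip m C (φ p))
    (hlim : ∀ x > (0:ℝ), Tendsto (fun p => φ p x) atTop (𝓝 (Φ x))) : BddLip m C Φ := by
  have key : ∀ δ > (0:ℝ), ∀ L : ℝ, ∃ σ : ℕ → ℕ, StrictMono σ ∧
      ContDiffOn ℝ m Φ (Ioo δ L) ∧
      ∀ j ≤ m, ∀ x ∈ Ioo δ L,
        Tendsto (fun p => iteratedDeriv j (φ (σ p)) x) atTop (𝓝 (iteratedDeriv j Φ x)) := by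
    intro δ hδ L
    obtain ⟨σ, hσ, ψ, hψ⟩ := BddLip.exists_subseq φ h (fun _ => 0) hδ
    have hu : ∀ j ≤ m, TendstoUniformlyOn (fun p => iteratedDeriv j (φ (σ p))) (ψ j) atTop
        (Ioo δ L) := by
      intro j hj
      refine ((hψ j hj L).mono (s' := Ioo δ L) ?_).congr ?_
      · exact fun x hx => ⟨by linarith [hx.1, hx.2], hx.2.le⟩
      · filter_upwards with p x hx
        simp [max_eq_left hx.1.le]
    have h2 := contDiffOn_of_tendstoUniformlyOn_iteratedDeriv isOpen_Ioo
      (Eventually.of_forall fun p => (h (σ p)).1.mono fun x hx => hδ.trans hx.1) hu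
    have heq : EqOn Φ (ψ 0) (Ioo δ L) := by
      intro x hx
      have h3 := (hu 0 (Nat.zero_le _)).tendsto_at hx
      simp only [iteratedDeriv_zero] at h3
      exact tendsto_nhds_unique ((hlim x (hδ.trans hx.1)).comp hσ.tendsto_atTop) h3
    refine ⟨σ, hσ, h2.1.congr heq, fun j hj x hx => ?_⟩
    have h4 : iteratedDeriv j Φ x = ψ j x := by
      rw [← h2.2 j hj x hx]
      exact (heq.eventuallyEq_of_mem (isOpen_Ioo.mem_nhds hx)).iteratedDeriv_eq j
    rw [h4]
    exact (hu j hj).tendsto_at hx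
  refine ⟨fun x hx => ?_, fun j hj x hx => ?_, fun x hx y hy => ?_⟩
  · have hx : (0:ℝ) < x := hx
    obtain ⟨σ, hσ, h1, -⟩ := key (x/2) (by linarith) (x+1)
    exact (h1.contDiffAt (isOpen_Ioo.mem_nhds ⟨by linarith, by linarith⟩)).contDiffWithinAt
  · obtain ⟨σ, hσ, -, h1⟩ := key (x/2) (by linarith) (x+1)
    refine le_of_tendsto (h1 j hj x ⟨by linarith, by linarith⟩).norm ?_
    exact Eventually.of_forall fun p => (h (σ p)).2.1 j hj x hx
  · obtain ⟨σ, hσ, -, h1⟩ := key (min x y/2) (by have := lt_min hx hy; linarith) (max x y + 1)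
    have hm := lt_min hx hy
    have hx' : x ∈ Ioo (min x y/2) (max x y + 1) :=
      ⟨by linarith [min_le_left x y], by linarith [le_max_left x y]⟩
    have hy' : y ∈ Ioo (min x y/2) (max x y + 1) :=
      ⟨by linarith [min_le_right x y], by linarith [le_max_right x y]⟩
    refine le_of_tendsto ((h1 m le_rfl x hx').sub (h1 m le_rfl y hy')).norm ?_
    exact Eventually.of_forall fun p => (h (σ p)).2.2 x hx y hy

/-- Local `C^m` compactness of translates going to infinity. -/
lemma BddLip.exists_subseq_translate [ProperSpace F] {m : ℕ} {C : ℝ} (φ : ℕ → ℝ → F)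
    (h : ∀ p, BddLip m C (φ p)) (ρ : ℕ → ℝ) (hρ : Tendsto ρ atTop atTop) :
    ∃ σ : ℕ → ℕ, StrictMono σ ∧ ∃ ψ : ℝ → F, ContDiff ℝ m ψ ∧
      (∀ j ≤ m, ∀ x, ‖iteratedDeriv j ψ x‖ ≤ C) ∧
      ∀ L : ℝ, ∀ j ≤ m, TendstoUniformlyOn
        (fun p x => iteratedDeriv j (fun s => φ (σ p) (ρ (σ p) + s)) x) (iteratedDeriv j ψ)
        atTop (Icc (-L) L) := by
  obtain ⟨σ, hσ, ψ, hψ⟩ := BddLip.exists_subseq φ h ρ one_pos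
  have hev : ∀ L : ℝ, ∀ᶠ p in atTop, 1 ≤ ρ (σ p) - L := fun L => by
    filter_upwards [(hρ.comp hσ.tendsto_atTop).eventually_ge_atTop (1 + L)] with p hp
    simp only [Function.comp_apply] at hp
    linarith
  have hu : ∀ j ≤ m, ∀ L : ℝ, TendstoUniformlyOn
      (fun p x => iteratedDeriv j (fun s => φ (σ p) (ρ (σ p) + s)) x) (ψ j)
        atTop (Icc (-L) L) := by
    intro j hj L
    refine (hψ j hj L).congr ?_
    filter_upwards [hev L] with p hp x hx
    rw [iteratedDeriv_comp_const_add]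
    simp only
    rw [max_eq_left (by linarith [hx.1])]
  have h2 : ∀ L : ℝ, ContDiffOn ℝ m (ψ 0) (Ioo (-L) L) ∧
      ∀ j ≤ m, ∀ x ∈ Ioo (-L) L, iteratedDeriv j (ψ 0) x = ψ j x := fun L => by
    refine contDiffOn_of_tendstoUniformlyOn_iteratedDeriv isOpen_Ioo
      (f := fun p s => φ (σ p) (ρ (σ p) + s)) ?_
      fun j hj => (hu j hj L).mono Ioo_subset_Icc_self
    filter_upwards [hev L] with p hp
    refine (h (σ p)).1.comp (by fun_prop) fun x hx => ?_
    simp only [mem_Ioi]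
    linarith [hx.1]
  have hmem : ∀ x : ℝ, x ∈ Ioo (-(|x|+1)) (|x|+1) := fun x =>
    ⟨by linarith [neg_abs_le x], by linarith [le_abs_self x]⟩
  have heq : ∀ j ≤ m, iteratedDeriv j (ψ 0) = ψ j := fun j hj => funext fun x =>
    (h2 (|x|+1)).2 j hj x (hmem x)
  refine ⟨σ, hσ, ψ 0, ?_, fun j hj x => ?_, fun L j hj => ?_⟩
  · rw [contDiff_iff_contDiffAt]
    exact fun x => (h2 (|x|+1)).1.contDiffAt (isOpen_Ioo.mem_nhds (hmem x))
  · rw [heq j hj]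
    refine le_of_tendsto ((hψ j hj (|x|+1)).tendsto_at (Ioo_subset_Icc_self (hmem x))).norm ?_
    exact Eventually.of_forall fun p =>
      (h (σ p)).2.1 j hj _ (one_pos.trans_le (le_max_right _ _))
  · rw [heq j hj]
    exact hu j hj L

end BddLip

lemma hasDerivAt_euclidean_of_forall {n : ℕ} {f : ℝ → Euc n} {g : Fin n → ℝ} {s : ℝ}
    (h : ∀ i, HasDerivAt (fun z => f z i) (g i) s) : HasDerivAt f (WithLp.toLp 2 g) s := by
  have h1 : HasDerivAt (fun z i => f z i) g s := hasDerivAt_pi.2 h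
  exact ((PiLp.hasFDerivAt_toLp (𝕜 := ℝ) 2 (fun i => f s i)).comp_hasDerivAt s h1)

/-- An absolutely continuous curve whose derivative is bounded by `C` where it exists is
`C`-Lipschitz. -/
lemma norm_sub_le_of_eq_integral_of_norm_deriv_le {n : ℕ} {f : ℝ → Euc n} {g : Fin n → ℝ → ℝ}
    {x y C : ℝ} (hxy : x ≤ y) (hg : ∀ i, IntervalIntegrable (g i) volume x y)
    (hf : ∀ i, ∀ z ∈ Icc x y, f z i = f x i + ∫ s in x..z, g i s)
    (hC : ∀ z ∈ Ioo x y, ‖deriv f z‖ ≤ C) : ‖f y - f x‖ ≤ C * (y - x) := by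
  have hae : ∀ᵐ s : ℝ, s ∈ Ioo x y → HasDerivAt f (WithLp.toLp 2 fun i => g i s) s := by
    have : ∀ᵐ s : ℝ, ∀ i, s ∈ uIcc x y → ∀ c ∈ uIcc x y,
        HasDerivAt (fun z => ∫ t in c..z, g i t) (g i s) s :=
      ae_all_iff.2 fun i => (hg i).ae_hasDerivAt_integral
    filter_upwards [this] with s hs hsI
    refine hasDerivAt_euclidean_of_forall fun i => ?_
    have h1 :=
      (hs i (by rw [uIcc_of_le hxy]; exact Ioo_subset_Icc_self hsI) x left_mem_uIcc).const_add
      (f x i)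
    refine h1.congr_of_eventuallyEq ?_
    filter_upwards [isOpen_Ioo.mem_nhds hsI] with z hz using hf i z (Ioo_subset_Icc_self hz)
  set v : Euc n := f y - f x with hv
  have hcomp : ∀ i, v i = ∫ s in x..y, g i s := fun i => by
    simp [hv, hf i y (right_mem_Icc.2 hxy)]
  have h2 : ‖v‖ ^ 2 = ∫ s in x..y, ∑ i, v i * g i s := by
    rw [intervalIntegral.integral_finsetSum fun i _ => (hg i).const_mul _,
      EuclideanSpace.real_norm_sq_eq]
    refine Finset.sum_congr rfl fun i _ => ?_
    rw [intervalIntegral.integral_const_mul, ← hcomp, sq]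
  have h3 : ‖∫ s in x..y, ∑ i, v i * g i s‖ ≤ (‖v‖ * C) * |y - x| := by
    apply intervalIntegral.norm_integral_le_of_norm_le_const_ae
    have hne : ∀ᵐ s : ℝ, s ≠ y := by simp [ae_iff]
    filter_upwards [hae, hne] with s hs hsy hsI
    rw [uIoc_of_le hxy] at hsI
    have hsI' : s ∈ Ioo x y := ⟨hsI.1, lt_of_le_of_ne hsI.2 hsy⟩
    have h4 := hC s hsI'
    rw [(hs hsI').deriv] at h4
    have h5 : ∑ i, v i * g i s = inner ℝ v (WithLp.toLp 2 fun i => g i s : Euc n) := by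
      rw [PiLp.inner_apply]
      exact Finset.sum_congr rfl fun i _ => by simp [mul_comm]
    rw [h5]
    exact (norm_inner_le_norm _ _).trans (by gcongr)
  rw [← h2, abs_of_nonneg (sub_nonneg.2 hxy), norm_pow, norm_norm] at h3
  rcases (norm_nonneg v).eq_or_lt with h0 | h0
  · rw [← h0]
    rcases hxy.eq_or_lt with rfl | hlt
    · simp
    · exact mul_nonneg ((norm_nonneg _).trans
        (hC ((x + y) / 2) ⟨by linarith, by linarith⟩)) (by linarith)
  · have : ‖v‖ * ‖v‖ ≤ ‖v‖ * (C * (y - x)) := by nlinarith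
    exact le_of_mul_le_mul_left this h0

/-- A Lipschitz curve whose derivative is bounded by `C` where it exists is `C`-Lipschitz. -/
lemma norm_sub_le_of_lipschitzOnWith_of_norm_deriv_le {n : ℕ} {f : ℝ → Euc n} {K : NNReal}
    {x y C : ℝ} (hxy : x ≤ y) (hf : LipschitzOnWith K f (Icc x y))
    (hC : ∀ z ∈ Ioo x y, ‖deriv f z‖ ≤ C) : ‖f y - f x‖ ≤ C * (y - x) := by
  have hac : ∀ i, ∀ z ∈ Icc x y, AbsolutelyContinuousOnInterval (fun s => f s i) x z := by
    intro i z hz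
    apply LipschitzOnWith.absolutelyContinuousOnInterval (K := K)
    rw [uIcc_of_le hz.1]
    refine LipschitzOnWith.of_dist_le_mul fun s hs s' hs' => ?_
    refine le_trans ?_ (hf.dist_le_mul s (Icc_subset_Icc_right hz.2 hs) s'
      (Icc_subset_Icc_right hz.2 hs'))
    rw [dist_eq_norm, dist_eq_norm]
    exact PiLp.norm_apply_le (f s - f s') i
  refine norm_sub_le_of_eq_integral_of_norm_deriv_le hxy
    (g := fun i => deriv fun s => f s i)
    (fun i => (hac i y (right_mem_Icc.2 hxy)).intervalIntegrable_deriv) (fun i z hz => ?_) hC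
  rw [(hac i z hz).integral_deriv_eq_sub]
  ring

/-- The angular frequency of the `n`-th Fourier mode of period `T`. -/
def freq (T : ℝ) (n : ℤ) : ℝ := 2 * Real.pi * n / T

/-- The conjugate of the `n`-th Fourier mode of period `T`. -/
def fker (T : ℝ) (n : ℤ) (x : ℝ) : ℂ := Complex.exp (-(Complex.I * freq T n * x))

/-- Unnormalized Fourier coefficients on `[a, a + T]`. -/
def fcoef (a T : ℝ) (φ : ℝ → ℂ) (n : ℤ) : ℂ := ∫ x in a..a + T, fker T n x * φ x

lemma hasDerivAt_fker (T : ℝ) (n : ℤ) (x : ℝ) :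
    HasDerivAt (fker T n) (-(Complex.I * freq T n) * fker T n x) x := by
  have h1 : HasDerivAt (fun x : ℝ => -(Complex.I * freq T n * (x:ℂ)))
      (-(Complex.I * freq T n)) x := by
    simpa using (((hasDerivAt_id x).ofReal_comp).const_mul (Complex.I * freq T n)).fun_neg
  have := h1.cexp
  rw [mul_comm (Complex.exp _)] at this
  exact this

lemma continuous_fker (T : ℝ) (n : ℤ) : Continuous (fker T n) := by
  unfold fker; fun_prop

lemma norm_fker (T : ℝ) (n : ℤ) (x : ℝ) : ‖fker T n x‖ = 1 := by
  have : -(Complex.I * freq T n * x) = ((-(freq T n * x) : ℝ) : ℂ) * Complex.I := by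
    push_cast; ring
  rw [fker, this, Complex.norm_exp_ofReal_mul_I]

lemma fourier_coe_eq_fker {T : ℝ} (n : ℤ) (x : ℝ) :
    fourier n (x : AddCircle T) = fker T (-n) x := by
  rw [fourier_coe_apply, fker, freq]
  congr 1
  push_cast
  ring

lemma fker_neg_freq (T : ℝ) (n : ℤ) : freq T (-n) = -freq T n := by
  simp [freq, neg_div]

lemma fcoef_deriv {a T : ℝ} {φ φ' : ℝ → ℂ} (hφ : ∀ x, HasDerivAt φ (φ' x) x)
    (hφ' : Continuous φ') (ha : φ a = 0) (hb : φ (a + T) = 0) (n : ℤ) :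
    fcoef a T φ' n = Complex.I * freq T n * fcoef a T φ n := by
  rw [fcoef, intervalIntegral.integral_mul_deriv_eq_deriv_mul
    (u := fker T n) (v := φ) (u' := fun x => -(Complex.I * freq T n) * fker T n x)
    (fun x _ => hasDerivAt_fker T n x) (fun x _ => hφ x)
    (Continuous.intervalIntegrable (by have := continuous_fker T n; fun_prop) _ _)
    (hφ'.intervalIntegrable _ _), ha, hb, fcoef, ← intervalIntegral.integral_const_mul]
  simp only [mul_zero, sub_zero, zero_sub]
  rw [← intervalIntegral.integral_neg]
  congr 1; ext x; ring

lemma hasSum_sq_fcoef {a T : ℝ} (hT : 0 < T) {φ : ℝ → ℂ} (hφ : Continuous φ) :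
    HasSum (fun n => ‖fcoef a T φ n‖ ^ 2) (T * ∫ x in a..a + T, ‖φ x‖ ^ 2) := by
  have hab : a < a + T := by linarith
  have hmem : MemLp φ 2 (volume.restrict (Ioc a (a + T))) := by
    have : MemLp φ 2 (volume.restrict (Icc a (a + T))) := by
      rw [memLp_two_iff_integrable_sq_norm hφ.aestronglyMeasurable]
      exact (by fun_prop : Continuous fun x => ‖φ x‖ ^ 2).continuousOn.integrableOn_compact
        isCompact_Icc
    exact this.mono_measure (Measure.restrict_mono Ioc_subset_Icc_self le_rfl)
  have h := (hasSum_sq_fourierCoeffOn hab hmem).mul_left (T ^ 2)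
  have hT' : T ≠ 0 := hT.ne'
  have h1 : (fun n => T ^ 2 * ‖fourierCoeffOn hab φ n‖ ^ 2) = fun n => ‖fcoef a T φ n‖ ^ 2 := by
    ext n
    rw [fourierCoeffOn_eq_integral, norm_smul, mul_pow, ← mul_assoc]
    have : fcoef a T φ n = ∫ x in a..a + T, fourier (-n) (x : AddCircle (a + T - a)) • φ x := by
      rw [fcoef]
      congr 1; ext x
      rw [fourier_coe_eq_fker, neg_neg, smul_eq_mul, add_sub_cancel_left]
    rw [← this, add_sub_cancel_left]
    simp only [one_div, norm_inv, Real.norm_eq_abs, inv_pow, sq_abs]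
    field_simp
  rw [h1, add_sub_cancel_left, smul_eq_mul] at h
  rwa [← mul_assoc, sq, mul_assoc T, mul_inv_cancel₀ hT', mul_one] at h

lemma hasSum_fcoef_mul_fker {a T : ℝ} (hT : 0 < T) {φ : ℝ → ℂ} (hφ : Continuous φ)
    (hper : φ a = φ (a + T)) (hs : Summable fun n => ‖fcoef a T φ n‖) {x : ℝ}
    (hx : x ∈ Ioc a (a + T)) :
    HasSum (fun n => (T : ℂ)⁻¹ * fcoef a T φ n * fker T (-n) x) (φ x) := by
  have := Fact.mk hT
  let f : C(AddCircle T, ℂ) := ⟨AddCircle.liftIoc T a φ,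
    AddCircle.liftIoc_continuous hper hφ.continuousOn⟩
  have hc : ∀ n, fourierCoeff f n = (T : ℂ)⁻¹ * fcoef a T φ n := by
    intro n
    have : fourierCoeff f n = fourierCoeff (AddCircle.liftIoc T a φ) n := rfl
    rw [this, fourierCoeff_liftIoc_eq, fourierCoeffOn_eq_integral, fcoef, add_sub_cancel_left,
      Complex.real_smul]
    push_cast
    rw [one_div]
    congr 2; ext x
    rw [fourier_coe_eq_fker, neg_neg, smul_eq_mul]
  have h := has_pointwise_sum_fourier_series_of_summable (f := f) (by
    rw [show fourierCoeff (f : AddCircle T → ℂ) = fun n => (T : ℂ)⁻¹ * fcoef a T φ n from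
      funext hc]
    exact hs.of_norm.mul_left _) (x : AddCircle T)
  have hfx : f (x : AddCircle T) = φ x := AddCircle.liftIoc_coe_apply hx
  simpa only [hc, hfx, fourier_coe_eq_fker, smul_eq_mul] using h

lemma setIntegral_haarAddCircle_Ioc {T : ℝ} [Fact (0 < T)] {a x y : ℝ} (hxy : x ≤ y)
    (hx : a ≤ x) (hy : y ≤ a + T) (h : AddCircle T → ℂ) :
    ∫ θ in AddCircle.measurableEquivIoc T a ⁻¹' (Subtype.val ⁻¹' Ioc x y), h θ
      ∂AddCircle.haarAddCircle = (T : ℂ)⁻¹ * ∫ s in x..y, h s := by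
  set A := AddCircle.measurableEquivIoc T a ⁻¹' (Subtype.val ⁻¹' Ioc x y) with hA
  have hAm : MeasurableSet A :=
    (AddCircle.measurableEquivIoc T a).measurable (measurable_subtype_coe measurableSet_Ioc)
  rw [← integral_indicator hAm, AddCircle.integral_haarAddCircle, ← AddCircle.integral_preimage T a,
    Complex.real_smul, intervalIntegral.integral_of_le hxy, Complex.ofReal_inv]
  congr 1
  have h1 : ∀ s ∈ Ioc a (a + T), A.indicator h (s : AddCircle T) =
      (Ioc x y).indicator (fun s : ℝ => h s) s := by
    intro s hs
    have : ((s : AddCircle T) ∈ A) ↔ s ∈ Ioc x y := by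
      simp only [hA, mem_preimage]
      have := AddCircle.equivIoc_coe_of_mem hs
      change ((AddCircle.equivIoc T a (s : AddCircle T) : ℝ) ∈ Ioc x y) ↔ _
      rw [this]
    by_cases hm : s ∈ Ioc x y
    · rw [indicator_of_mem hm, indicator_of_mem (this.2 hm)]
    · rw [indicator_of_notMem hm, indicator_of_notMem (fun h => hm (this.1 h))]
  rw [setIntegral_congr_fun measurableSet_Ioc h1, setIntegral_indicator measurableSet_Ioc,
    inter_eq_self_of_subset_right (Ioc_subset_Ioc hx hy)]

lemma freq_ne_zero {T : ℝ} (hT : 0 < T) {n : ℤ} (hn : n ≠ 0) : freq T n ≠ 0 := by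
  have := Real.pi_pos
  unfold freq
  positivity

lemma freq_sq_ge {T : ℝ} {n : ℤ} (hn : n ≠ 0) : freq T 1 ^ 2 ≤ freq T n ^ 2 := by
  have : (1:ℝ) ≤ (n:ℝ) ^ 2 := by
    have : 1 ≤ n ^ 2 := by have := sq_pos_of_ne_zero hn; omega
    exact_mod_cast this
  have h : freq T n ^ 2 = freq T 1 ^ 2 * (n:ℝ)^2 := by
    unfold freq; push_cast; ring
  rw [h]
  nlinarith [sq_nonneg (freq T 1)]

lemma eventually_cofinite_ne_zero : ∀ᶠ n : ℤ in cofinite, n ≠ 0 :=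
  (Set.finite_singleton (0:ℤ)).subset (fun n hn => by simpa using hn)

lemma Summable.freq_pow_mono {T : ℝ} (hT : 0 < T) {y : ℤ → ℝ} (hy : ∀ n, 0 ≤ y n) {p : ℕ}
    (h : Summable fun n => freq T n ^ (2 * (p + 1)) * y n) :
    Summable fun n => freq T n ^ (2 * p) * y n := by
  have h1 : 0 < freq T 1 ^ 2 := by
    have := freq_ne_zero hT (one_ne_zero (α := ℤ)); positivity
  refine Summable.of_norm_bounded_eventually (h.mul_left (freq T 1 ^ 2)⁻¹) ?_
  filter_upwards [eventually_cofinite_ne_zero] with n hn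
  have h2 := freq_sq_ge (T := T) hn
  rw [Real.norm_of_nonneg (mul_nonneg (by rw [pow_mul]; positivity) (hy n)), ← div_eq_inv_mul,
    le_div_iff₀ h1, mul_add, pow_add]
  have h3 : 0 ≤ freq T n ^ (2 * p) * y n := mul_nonneg (by rw [pow_mul]; positivity) (hy n)
  calc freq T n ^ (2 * p) * y n * freq T 1 ^ 2 ≤ freq T n ^ (2 * p) * y n * freq T n ^ 2 :=
        mul_le_mul_of_nonneg_left h2 h3
    _ = _ := by ring

lemma summable_norm_of_summable_freq {T : ℝ} (hT : 0 < T) {c : ℤ → ℂ}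
    (h : Summable fun n => freq T n ^ 2 * ‖c n‖ ^ 2) : Summable fun n => ‖c n‖ := by
  have h1 : Summable fun n : ℤ => (freq T n ^ 2)⁻¹ := by
    have := (Real.summable_one_div_int_pow (p := 2)).2 one_lt_two
    refine (this.mul_left (T / (2 * Real.pi)) |>.mul_left (T / (2 * Real.pi))).congr fun n => ?_
    rw [freq, div_pow, inv_div, mul_pow]
    ring
  refine Summable.of_norm_bounded_eventually (h.add h1) ?_
  filter_upwards [eventually_cofinite_ne_zero] with n hn
  have h0 := freq_ne_zero hT hn
  rw [norm_norm]
  have h2 : |freq T n| * ‖c n‖ * |freq T n|⁻¹ = ‖c n‖ := by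
    have : |freq T n| ≠ 0 := abs_ne_zero.2 h0
    field_simp
  have h3 : freq T n ^ 2 * ‖c n‖ ^ 2 = (|freq T n| * ‖c n‖) ^ 2 := by rw [mul_pow, sq_abs]
  have h4 : (freq T n ^ 2)⁻¹ = (|freq T n|⁻¹) ^ 2 := by rw [inv_pow, sq_abs]
  rw [h3, h4]
  nlinarith [sq_nonneg (|freq T n| * ‖c n‖ - |freq T n|⁻¹), sq_nonneg (|freq T n| * ‖c n‖),
    sq_nonneg (|freq T n|⁻¹)]

/-- A periodic `H¹` function is the integral of an integrable function. -/
lemma exists_integral_eq_of_summable_freq {a T : ℝ} (hT : 0 < T) {φ : ℝ → ℂ} (hφ : Continuous φ)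
    (hper : φ a = φ (a + T)) (hs : Summable fun n => freq T n ^ 2 * ‖fcoef a T φ n‖ ^ 2) :
    ∃ g : ℝ → ℂ, IntervalIntegrable g volume a (a + T) ∧
      ∀ x ∈ Ioc a (a + T), ∀ y ∈ Ioc a (a + T), x ≤ y → φ y - φ x = ∫ s in x..y, g s := by
  have := Fact.mk hT
  have hTc : (T : ℂ) ≠ 0 := by exact_mod_cast hT.ne'
  let w : ℤ → ℂ := fun n => (T : ℂ)⁻¹ * fcoef a T φ n * (Complex.I * freq T n)
  have hw : Memℓp w 2 := by
    rw [memℓp_gen_iff (by norm_num)]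
    refine (hs.mul_left (T⁻¹ ^ 2)).congr fun n => ?_
    simp [w, mul_pow]
    ring
  let G : Lp ℂ 2 (AddCircle.haarAddCircle (T := T)) := fourierBasis.repr.symm ⟨w, hw⟩
  have hG : HasSum (fun n => w n • fourierLp (T := T) 2 n) G := by
    have := (fourierBasis (T := T)).hasSum_repr_symm (⟨w, hw⟩ : lp (fun _ : ℤ => ℂ) 2)
    simpa [coe_fourierBasis] using this
  refine ⟨fun s => G (s : AddCircle T), ?_, fun x hx y hy hxy => ?_⟩
  · have h1 : Integrable G (volume : Measure (AddCircle T)) := by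
      rw [AddCircle.volume_eq_smul_haarAddCircle]
      exact ((Lp.memLp G).integrable (by norm_num)).smul_measure (by simp)
    have h2 := (AddCircle.measurePreserving_mk T a).integrable_comp_of_integrable h1
    rw [intervalIntegrable_iff_integrableOn_Ioc_of_le (by linarith)]
    exact h2
  · have hAm : MeasurableSet (AddCircle.measurableEquivIoc T a ⁻¹' (Subtype.val ⁻¹' Ioc x y)) :=
      (AddCircle.measurableEquivIoc T a).measurable (measurable_subtype_coe measurableSet_Ioc)
    have hAf : AddCircle.haarAddCircle
        (AddCircle.measurableEquivIoc T a ⁻¹' (Subtype.val ⁻¹' Ioc x y)) ≠ ⊤ := measure_ne_top _ _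
    have h1 := hG.mapL (innerSL ℂ (indicatorConstLp 2 hAm hAf (1:ℂ)))
    simp only [innerSL_apply_apply, inner_smul_right, L2.inner_indicatorConstLp_one] at h1
    rw [setIntegral_haarAddCircle_Ioc hxy hx.1.le hy.2] at h1
    have h2 : ∀ n, ∫ θ in AddCircle.measurableEquivIoc T a ⁻¹' (Subtype.val ⁻¹' Ioc x y),
        fourierLp (T := T) 2 n θ ∂AddCircle.haarAddCircle =
          (T : ℂ)⁻¹ * ∫ s in x..y, fker T (-n) s := by
      intro n
      rw [integral_congr_ae (ae_restrict_of_ae (coeFn_fourierLp 2 n)),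
        setIntegral_haarAddCircle_Ioc hxy hx.1.le hy.2]
      simp only [fourier_coe_eq_fker]
    simp only [h2] at h1
    have h3 : ∀ n, Complex.I * freq T n * ∫ s in x..y, fker T (-n) s =
        fker T (-n) y - fker T (-n) x := by
      intro n
      rw [← intervalIntegral.integral_const_mul]
      refine intervalIntegral.integral_eq_sub_of_hasDerivAt (fun s _ => ?_)
        (Continuous.intervalIntegrable (by have := continuous_fker T (-n); fun_prop) _ _)
      have := hasDerivAt_fker T (-n) s
      rw [fker_neg_freq] at this
      simpa using this
    have hsum := summable_norm_of_summable_freq hT hs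
    have h4 := (hasSum_fcoef_mul_fker hT hφ hper hsum hy).sub
      (hasSum_fcoef_mul_fker hT hφ hper hsum hx)
    have h5 := h1.mul_left (T : ℂ)
    have h6 : (fun n => (T : ℂ) * (w n * ((T : ℂ)⁻¹ * ∫ s in x..y, fker T (-n) s))) =
        fun n => (T : ℂ)⁻¹ * fcoef a T φ n * fker T (-n) y -
          (T : ℂ)⁻¹ * fcoef a T φ n * fker T (-n) x := by
      ext n
      rw [← mul_sub, ← h3]
      simp only [w]
      field_simp
    rw [h6] at h5
    rw [h4.unique h5]
    field_simp

lemma tsupport_iteratedDeriv_subset {F : Type*} [NormedAddCommGroup F] [NormedSpace ℝ F]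
    (φ : ℝ → F) (j : ℕ) : tsupport (iteratedDeriv j φ) ⊆ tsupport φ := by
  induction j with
  | zero => simp
  | succ j ih =>
    rw [iteratedDeriv_succ]
    exact tsupport_deriv_subset.trans ih

lemma eq_zero_of_tsupport_subset {F : Type*} [Zero F] {φ : ℝ → F} {s : Set ℝ}
    (h : tsupport φ ⊆ s) {x : ℝ} (hx : x ∉ s) : φ x = 0 :=
  image_eq_zero_of_notMem_tsupport fun hx' => hx (h hx')

lemma fcoef_iteratedDeriv {a T : ℝ} {φ : ℝ → ℂ} {j : ℕ} (hφ : ContDiff ℝ j φ)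
    (hs : tsupport φ ⊆ Ioo a (a + T)) (n : ℤ) :
    fcoef a T (iteratedDeriv j φ) n = (Complex.I * freq T n) ^ j * fcoef a T φ n := by
  induction j with
  | zero => simp
  | succ j ih =>
    have hz := (tsupport_iteratedDeriv_subset φ j).trans hs
    rw [fcoef_deriv (φ := iteratedDeriv j φ) (fun x => ?_)
      (hφ.continuous_iteratedDeriv (j + 1) le_rfl) (eq_zero_of_tsupport_subset hz (by simp))
      (eq_zero_of_tsupport_subset hz (by simp)), ih (hφ.of_le (by exact_mod_cast j.le_succ)),
      pow_succ]
    · ring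
    · rw [iteratedDeriv_succ]
      exact (hφ.differentiable_iteratedDeriv j (by exact_mod_cast j.lt_succ_self) x).hasDerivAt

/-- Bessel-type bound for the weighted Fourier coefficients of a compactly supported `C^j`
function. -/
lemma sum_freq_pow_mul_sq_fcoef_le {a T M : ℝ} (hT : 0 < T) {φ : ℝ → ℂ} {j : ℕ}
    (hφ : ContDiff ℝ j φ) (hs : tsupport φ ⊆ Ioo a (a + T))
    (hM : ∀ x, ‖iteratedDeriv j φ x‖ ≤ M) (s : Finset ℤ) :
    ∑ n ∈ s, freq T n ^ (2 * j) * ‖fcoef a T φ n‖ ^ 2 ≤ T ^ 2 * M ^ 2 := by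
  have hc := hφ.continuous_iteratedDeriv j le_rfl
  have h := hasSum_sq_fcoef (a := a) hT hc
  have h1 : (fun n => ‖fcoef a T (iteratedDeriv j φ) n‖ ^ 2) =
      fun n => freq T n ^ (2 * j) * ‖fcoef a T φ n‖ ^ 2 := by
    ext n
    rw [fcoef_iteratedDeriv hφ hs, norm_mul, norm_pow, norm_mul, Complex.norm_I, one_mul,
      Complex.norm_real, mul_pow, ← pow_mul, mul_comm j 2, pow_mul, pow_mul, Real.norm_eq_abs,
      sq_abs]
  rw [h1] at h
  refine (sum_le_hasSum s (fun n _ => ?_) h).trans ?_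
  · rw [pow_mul]; positivity
  · have h2 : ∫ x in a..a + T, ‖iteratedDeriv j φ x‖ ^ 2 ≤ ∫ x in a..a + T, M ^ 2 := by
      apply intervalIntegral.integral_mono_on (by linarith)
        (Continuous.intervalIntegrable (by fun_prop) _ _) (by simp)
      intro x _
      have := hM x
      gcongr
    rw [intervalIntegral.integral_const, add_sub_cancel_left, smul_eq_mul] at h2
    calc _ ≤ T * (T * M ^ 2) := by gcongr
      _ = _ := by ring

/-- Decay of the Fourier coefficients gives regularity. -/
lemma contDiff_of_summable_freq {a T : ℝ} (hT : 0 < T) (m : ℕ) : ∀ {φ : ℝ → ℂ},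
    Continuous φ → tsupport φ ⊆ Ioo a (a + T) →
    (Summable fun n => freq T n ^ (2 * (m + 1)) * ‖fcoef a T φ n‖ ^ 2) →
    ContDiff ℝ m φ ∧ ∃ g : ℝ → ℂ, IntervalIntegrable g volume a (a + T) ∧
      ∀ x ∈ Ioc a (a + T), ∀ y ∈ Ioc a (a + T), x ≤ y →
        iteratedDeriv m φ y - iteratedDeriv m φ x = ∫ s in x..y, g s := by
  induction m with
  | zero =>
    intro φ hφ hsupp hs
    refine ⟨by simpa [contDiff_zero] using hφ, ?_⟩
    simp only [iteratedDeriv_zero]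
    refine exists_integral_eq_of_summable_freq hT hφ ?_ (by simpa using hs)
    rw [eq_zero_of_tsupport_subset hsupp (by simp), eq_zero_of_tsupport_subset hsupp (by simp)]
  | succ m ih =>
    intro φ hφ hsupp hs
    have hpow : ∀ p, Summable (fun n => freq T n ^ (2 * (p + 2)) * ‖fcoef a T φ n‖ ^ 2) →
        Summable fun n => freq T n ^ (2 * 2) * ‖fcoef a T φ n‖ ^ 2 := by
      intro p
      induction p with
      | zero => exact id
      | succ p ihp => exact fun h => ihp (Summable.freq_pow_mono hT (fun n => by positivity) h)
    have hs2 : Summable fun n => freq T n ^ (2 * 2) * ‖fcoef a T φ n‖ ^ 2 := hpow m hs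
    have hs1 : Summable fun n => freq T n ^ 2 * ‖fcoef a T φ n‖ ^ 2 := by
      simpa using Summable.freq_pow_mono hT (p := 1) (fun n => by positivity) hs2
    have hn1 := summable_norm_of_summable_freq hT hs1
    have hn2 : Summable fun n => ‖freq T n * fcoef a T φ n‖ := by
      refine summable_norm_of_summable_freq hT (hs2.congr fun n => ?_)
      rw [norm_mul, Complex.norm_real, mul_pow, Real.norm_eq_abs, sq_abs]
      ring
    have hend : φ a = φ (a + T) := by
      rw [eq_zero_of_tsupport_subset hsupp (by simp), eq_zero_of_tsupport_subset hsupp (by simp)]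
    -- the Fourier series and its termwise derivative
    let S : ℝ → ℂ := fun x => ∑' n, (T : ℂ)⁻¹ * fcoef a T φ n * fker T (-n) x
    let S' : ℝ → ℂ := fun x => ∑' n, (T : ℂ)⁻¹ * fcoef a T φ n *
      (Complex.I * freq T n * fker T (-n) x)
    have hbd : ∀ n x, ‖(T : ℂ)⁻¹ * fcoef a T φ n * (Complex.I * freq T n * fker T (-n) x)‖ ≤
        T⁻¹ * ‖freq T n * fcoef a T φ n‖ := fun n x => by
      simp only [norm_mul, norm_fker, Complex.norm_I, norm_inv, Complex.norm_real,
        Real.norm_of_nonneg hT.le]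
      exact le_of_eq (by ring)
    have hS : ∀ x, HasDerivAt S (S' x) x := by
      refine hasDerivAt_tsum (hn2.mul_left T⁻¹) (fun n x => ?_) hbd (y₀ := a + T) ?_
      · refine HasDerivAt.const_mul _ ?_
        have := hasDerivAt_fker T (-n) x
        rw [fker_neg_freq] at this
        simpa using this
      · exact (hasSum_fcoef_mul_fker hT hφ hend hn1 (by simpa using hT)).summable
    have hS'c : Continuous S' := by
      refine continuous_tsum (fun n => ?_) (hn2.mul_left T⁻¹) hbd
      have := continuous_fker T (-n)
      fun_prop
    have heq : EqOn φ S (Ioo a (a + T)) := fun x hx =>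
      (hasSum_fcoef_mul_fker hT hφ hend hn1 (Ioo_subset_Ioc_self hx)).tsum_eq.symm
    have hd : ∀ x, DifferentiableAt ℝ φ x ∧ ContinuousAt (deriv φ) x := by
      intro x
      by_cases hx : x ∈ tsupport φ
      · have hx' := isOpen_Ioo.mem_nhds (hsupp hx)
        have hev : ∀ y ∈ Ioo a (a + T), HasDerivAt φ (S' y) y := fun y hy =>
          (hS y).congr_of_eventuallyEq (heq.eventuallyEq_of_mem (isOpen_Ioo.mem_nhds hy))
        refine ⟨(hev x (hsupp hx)).differentiableAt, hS'c.continuousAt.congr ?_⟩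
        filter_upwards [hx'] with y hy using (hev y hy).deriv.symm
      · have hev : φ =ᶠ[𝓝 x] fun _ => 0 := by
          filter_upwards [(isClosed_tsupport φ).isOpen_compl.mem_nhds hx] with y hy
          exact image_eq_zero_of_notMem_tsupport hy
        refine ⟨(differentiableAt_const 0).congr_of_eventuallyEq hev, ?_⟩
        have h2 := hev.deriv
        rw [deriv_const'] at h2
        exact continuousAt_const.congr h2.symm
    have hφ'c : Continuous (deriv φ) := continuous_iff_continuousAt.2 fun x => (hd x).2
    have hcoef : ∀ n, fcoef a T (deriv φ) n = Complex.I * freq T n * fcoef a T φ n :=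
      fcoef_deriv (fun x => (hd x).1.hasDerivAt) hφ'c (eq_zero_of_tsupport_subset hsupp (by simp))
        (eq_zero_of_tsupport_subset hsupp (by simp))
    obtain ⟨h1, g, hg, h2⟩ := ih hφ'c (tsupport_deriv_subset.trans hsupp) (hs.congr fun n => by
      rw [hcoef, norm_mul, norm_mul, Complex.norm_I, one_mul, Complex.norm_real, mul_pow,
        Real.norm_eq_abs, sq_abs]
      ring)
    refine ⟨?_, g, hg, by simpa only [iteratedDeriv_succ'] using h2⟩
    push_cast
    rw [contDiff_succ_iff_deriv]
    exact ⟨fun x => (hd x).1, by simp, h1⟩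

/-- Parabolic smoothing for a single Fourier mode. -/
lemma energy_mode_le {c F : ℝ → ℂ} {l α β : ℝ} (hl : l ≠ 0) (hα : 0 < α) (hαβ : α ≤ β)
    (hc : ∀ t > 0, HasDerivAt c (-(l : ℂ) ^ 2 * c t + F t) t) (hF : ContinuousOn F (Ioi 0)) :
    l ^ 2 * ((α / 2) * ∫ t in α..β, ‖c t‖ ^ 2) ≤
      (∫ t in (α / 2)..β, ‖c t‖ ^ 2) + β * ((l ^ 2)⁻¹ * ∫ t in (α / 2)..β, ‖F t‖ ^ 2) := by
  have hsub : ∀ {x y : ℝ}, α / 2 ≤ x → α / 2 ≤ y → uIcc x y ⊆ Ioi 0 := fun {x y} hx hy z hz => by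
    have := (le_inf hx hy).trans hz.1
    exact (half_pos hα).trans_le this
  have hcc : ContinuousOn c (Ioi 0) := fun t ht => (hc t ht).continuousAt.continuousWithinAt
  have int : ∀ {f : ℝ → ℝ}, ContinuousOn f (Ioi 0) → ∀ {x y : ℝ}, α / 2 ≤ x → α / 2 ≤ y →
      IntervalIntegrable f volume x y := fun hf _ _ hx hy =>
    (hf.mono (hsub hx hy)).intervalIntegrable
  have hβ : α / 2 ≤ β := by linarith
  have hα2 : α / 2 ≤ α := by linarith
  have hl2 : 0 < l ^ 2 := by positivity
  let h : ℝ → ℝ := fun t => (t - α / 2) * ‖c t‖ ^ 2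
  let h' : ℝ → ℝ := fun t => ‖c t‖ ^ 2 +
    (t - α / 2) * (2 * inner ℝ (c t) (-(l : ℂ) ^ 2 * c t + F t))
  have hh : ∀ t > 0, HasDerivAt h (h' t) t := fun t ht => by
    have h1 := ((hasDerivAt_id t).sub_const (α / 2)).mul ((hc t ht).norm_sq)
    rw [one_mul] at h1
    exact h1
  have hh'c : ContinuousOn h' (Ioi 0) := by
    simp only [h']
    fun_prop
  have hftc : ∫ t in (α / 2)..β, h' t = h β - h (α / 2) :=
    intervalIntegral.integral_eq_sub_of_hasDerivAt
      (fun t ht => hh t (hsub le_rfl hβ ht)) (int hh'c le_rfl hβ)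
  have hnn : 0 ≤ ∫ t in (α / 2)..β, h' t := by
    rw [hftc]
    simp only [h, sub_self, zero_mul, sub_zero]
    have : 0 ≤ β - α / 2 := by linarith
    positivity
  have hbound : ∀ t ∈ Icc (α / 2) β, h' t ≤
      ‖c t‖ ^ 2 + β * ((l ^ 2)⁻¹ * ‖F t‖ ^ 2) - l ^ 2 * ((t - α / 2) * ‖c t‖ ^ 2) := by
    intro t ht
    have h1 : inner ℝ (c t) (-(l : ℂ) ^ 2 * c t + F t) =
        -l ^ 2 * ‖c t‖ ^ 2 + inner ℝ (c t) (F t) := by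
      rw [inner_add_right]
      congr 1
      have : -(l : ℂ) ^ 2 * c t = (-l ^ 2 : ℝ) • c t := by
        rw [Complex.real_smul]; push_cast; ring
      rw [this, real_inner_smul_right, real_inner_self_eq_norm_sq]
    have h2 : 2 * inner ℝ (c t) (F t) ≤ l ^ 2 * ‖c t‖ ^ 2 + (l ^ 2)⁻¹ * ‖F t‖ ^ 2 := by
      have h3 := real_inner_le_norm (c t) (F t)
      have h4 : |l| * ‖c t‖ * (|l|⁻¹ * ‖F t‖) = ‖c t‖ * ‖F t‖ := by
        have : |l| ≠ 0 := abs_ne_zero.2 hl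
        field_simp
      have h5 : l ^ 2 * ‖c t‖ ^ 2 + (l ^ 2)⁻¹ * ‖F t‖ ^ 2 =
          (|l| * ‖c t‖) ^ 2 + (|l|⁻¹ * ‖F t‖) ^ 2 := by
        rw [mul_pow, mul_pow, inv_pow, sq_abs]
      rw [h5]
      nlinarith [sq_nonneg (|l| * ‖c t‖ - |l|⁻¹ * ‖F t‖)]
    have h6 : 0 ≤ t - α / 2 := by linarith [ht.1]
    have h7 : t - α / 2 ≤ β := by linarith [ht.2]
    have h8 : 0 ≤ (l ^ 2)⁻¹ * ‖F t‖ ^ 2 := by positivity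
    simp only [h']
    rw [h1]
    have h9 := mul_le_mul_of_nonneg_left h2 h6
    have h10 := mul_le_mul_of_nonneg_right h7 h8
    nlinarith
  have hmono := hnn.trans <| intervalIntegral.integral_mono_on hβ (int hh'c le_rfl hβ)
    (int (by fun_prop) le_rfl hβ) hbound
  rw [intervalIntegral.integral_sub (int (by fun_prop) le_rfl hβ) (int (by fun_prop) le_rfl hβ),
    intervalIntegral.integral_add (int (by fun_prop) le_rfl hβ) (int (by fun_prop) le_rfl hβ),
    intervalIntegral.integral_const_mul, intervalIntegral.integral_const_mul,
    intervalIntegral.integral_const_mul] at hmono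
  have hlow : (α / 2) * ∫ t in α..β, ‖c t‖ ^ 2 ≤ ∫ t in (α / 2)..β, (t - α / 2) * ‖c t‖ ^ 2 := by
    rw [← intervalIntegral.integral_add_adjacent_intervals (b := α)
      (int (by fun_prop) le_rfl hα2) (int (by fun_prop) hα2 hβ),
      ← intervalIntegral.integral_const_mul]
    have p1 : 0 ≤ ∫ t in (α / 2)..α, (t - α / 2) * ‖c t‖ ^ 2 :=
      intervalIntegral.integral_nonneg hα2 fun t ht =>
        mul_nonneg (by linarith [ht.1]) (by positivity)
    have p2 : ∫ t in α..β, (α / 2) * ‖c t‖ ^ 2 ≤ ∫ t in α..β, (t - α / 2) * ‖c t‖ ^ 2 :=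
      intervalIntegral.integral_mono_on hαβ (int (by fun_prop) hα2 hβ)
        (int (by fun_prop) hα2 hβ) fun t ht =>
          mul_le_mul_of_nonneg_right (by linarith [ht.1]) (by positivity)
    linarith
  have := mul_le_mul_of_nonneg_left hlow hl2.le
  linarith

/-- A summable sequence of integrals of nonnegative functions is summable almost everywhere. -/
lemma ae_summable_of_summable_integral {y : ℤ → ℝ → ℝ} {w : ℤ → ℝ} {α β : ℝ} (hαβ : α ≤ β)
    (hw : ∀ n, 0 ≤ w n) (hy0 : ∀ n t, 0 ≤ y n t)
    (hy : ∀ n, ContinuousOn (y n) (Icc α β))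
    (hs : Summable fun n => w n * ∫ t in α..β, y n t) :
    ∀ᵐ t ∂(volume.restrict (Ioc α β)), Summable fun n => w n * y n t := by
  have hint : ∀ n, Integrable (fun t => w n * y n t) (volume.restrict (Ioc α β)) := fun n =>
    (((hy n).integrableOn_Icc).mono_set Ioc_subset_Icc_self).const_mul _
  have h1 : ∑' n, ∫⁻ t in Ioc α β, ENNReal.ofReal (w n * y n t) ≠ ⊤ := by
    have : ∀ n, ∫⁻ t in Ioc α β, ENNReal.ofReal (w n * y n t) =
        ENNReal.ofReal (w n * ∫ t in α..β, y n t) := fun n => by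
      rw [← ofReal_integral_eq_lintegral_ofReal (hint n)
        (Eventually.of_forall fun t => mul_nonneg (hw n) (hy0 n t)), integral_const_mul,
        intervalIntegral.integral_of_le hαβ]
    simp_rw [this]
    exact hs.tsum_ofReal_ne_top
  rw [← lintegral_tsum fun n => (hint n).aestronglyMeasurable.aemeasurable.ennreal_ofReal] at h1
  have h2 := ae_lt_top' (AEMeasurable.tsum fun n =>
    (hint n).aestronglyMeasurable.aemeasurable.ennreal_ofReal) h1
  filter_upwards [h2] with t ht
  refine (ENNReal.summable_toReal ht.ne).congr fun n => ?_
  rw [ENNReal.toReal_ofReal (mul_nonneg (hw n) (hy0 n t))]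

/-- Smooth cutoff functions supported in the open interval `(a, b)`. -/
def IsCutoff (a b : ℝ) (η : ℝ → ℝ) : Prop :=
  (∀ m : ℕ, ContDiff ℝ m η) ∧ tsupport η ⊆ Ioo a b

lemma IsCutoff.deriv {a b : ℝ} {η : ℝ → ℝ} (h : IsCutoff a b η) : IsCutoff a b (deriv η) := by
  refine ⟨fun m => ?_, tsupport_deriv_subset.trans h.2⟩
  have := h.1 (m + 1)
  push_cast at this
  exact (contDiff_succ_iff_deriv.1 this).2.2

lemma contDiff_of_tsupport_subset_of_contDiffOn {E : Type*} [NormedAddCommGroup E]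
    [NormedSpace ℝ E] {m : ℕ} {φ : ℝ → E} {s : Set ℝ} (hs : IsOpen s) (hsupp : tsupport φ ⊆ s)
    (hφ : ContDiffOn ℝ m φ s) : ContDiff ℝ m φ := by
  refine contDiff_iff_contDiffAt.2 fun x => ?_
  by_cases hx : x ∈ tsupport φ
  · exact (hφ x (hsupp hx)).contDiffAt (hs.mem_nhds (hsupp hx))
  · have : φ =ᶠ[𝓝 x] fun _ => 0 := notMem_tsupport_iff_eventuallyEq.1 hx
    exact contDiffAt_const.congr_of_eventuallyEq this

lemma IsCutoff.div {a b : ℝ} (ha : 0 < a) {η : ℝ → ℝ} (h : IsCutoff a b η) (q : ℝ) :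
    IsCutoff a b (fun x => η x * (q / x)) := by
  have hs : tsupport (fun x => η x * (q / x)) ⊆ Ioo a b := tsupport_mul_subset_left.trans h.2
  refine ⟨fun m => contDiff_of_tsupport_subset_of_contDiffOn isOpen_Ioo hs ?_, hs⟩
  exact (h.1 m).contDiffOn.mul (contDiffOn_const.div contDiffOn_id fun x hx =>
    (ha.trans hx.1).ne')

lemma IsCutoff.differentiable {a b : ℝ} {η : ℝ → ℝ} (h : IsCutoff a b η) :
    Differentiable ℝ η :=
  (h.1 1).differentiable (by norm_num)

lemma IsCutoff.continuous {a b : ℝ} {η : ℝ → ℝ} (h : IsCutoff a b η) : Continuous η :=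
  h.differentiable.continuous

lemma IsCutoff.exists_bound {a b : ℝ} {η : ℝ → ℝ} (h : IsCutoff a b η) :
    ∃ K, ∀ x, |η x| ≤ K := by
  have hc : HasCompactSupport η := HasCompactSupport.of_support_subset_isCompact
    (isCompact_Icc (a := a) (b := b))
    ((subset_tsupport η).trans (h.2.trans Ioo_subset_Icc_self))
  exact h.continuous.bounded_above_of_compact_support hc

lemma IsCutoff.left_eq_zero {a b : ℝ} {η : ℝ → ℝ} (h : IsCutoff a b η) : η a = 0 :=
  eq_zero_of_tsupport_subset h.2 (by simp)

lemma IsCutoff.right_eq_zero {a b : ℝ} {η : ℝ → ℝ} (h : IsCutoff a b η) : η b = 0 :=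
  eq_zero_of_tsupport_subset h.2 (by simp)

/-- Fourier coefficients of the localized profile `η * w (·, t)`. -/
def locCoef (a T : ℝ) (w : ℝ → ℝ → ℝ) (η : ℝ → ℝ) (n : ℤ) (t : ℝ) : ℂ :=
  fcoef a T (fun x => ((η x * w x t : ℝ) : ℂ)) n

lemma continuousOn_locCoef {a T C : ℝ} (ha : 0 < a) (hT : 0 < T) {w : ℝ → ℝ → ℝ}
    (hw : ∀ x > 0, ∀ t > 0, |w x t| ≤ C)
    (hwx : ∀ t > 0, ContinuousOn (fun x => w x t) (Ioi 0))
    (hwt : ∀ x > 0, ContinuousOn (w x) (Ioi 0)) {η : ℝ → ℝ} (hη : IsCutoff a (a + T) η) (n : ℤ) :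
    ContinuousOn (locCoef a T w η n) (Ioi 0) := by
  obtain ⟨K, hK⟩ := hη.exists_bound
  have hpos : ∀ x ∈ uIoc a (a + T), 0 < x := fun x hx => by
    rw [uIoc_of_le (by linarith)] at hx; exact ha.trans hx.1
  intro t ht
  refine ContinuousAt.continuousWithinAt ?_
  refine intervalIntegral.continuousAt_of_dominated_interval (bound := fun _ => K * C) ?_ ?_
    (by simp) ?_
  · filter_upwards [lt_mem_nhds ht] with s hs
    refine ContinuousOn.aestronglyMeasurable ?_ measurableSet_uIoc
    have h1 : ContinuousOn (fun x => η x * w x s) (uIoc a (a + T)) :=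
      hη.continuous.continuousOn.mul ((hwx s hs).mono hpos)
    exact (continuous_fker T n).continuousOn.mul (Complex.continuous_ofReal.comp_continuousOn h1)
  · filter_upwards [lt_mem_nhds ht] with s hs
    refine Eventually.of_forall fun x hx => ?_
    rw [norm_mul, norm_fker, one_mul, Complex.norm_real, Real.norm_eq_abs, abs_mul]
    exact mul_le_mul (hK x) (hw x (hpos x hx) s hs) (abs_nonneg _) ((abs_nonneg _).trans (hK x))
  · refine Eventually.of_forall fun x hx => ?_
    have := (hwt x (hpos x hx)).continuousAt (Ioi_mem_nhds ht)
    exact continuousAt_const.mul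
      (Complex.continuous_ofReal.continuousAt.comp (continuousAt_const.mul this))

lemma hasDerivAt_locCoef {a T C : ℝ} (ha : 0 < a) (hT : 0 < T) {v vt : ℝ → ℝ → ℝ}
    (hv : ∀ t > 0, ContinuousOn (fun x => v x t) (Ioi 0))
    (hvt : ∀ x > 0, ∀ t > 0, HasDerivAt (v x) (vt x t) t)
    (hvtc : ∀ t > 0, ContinuousOn (fun x => vt x t) (Ioi 0))
    (hb : ∀ x > 0, ∀ t > 0, |vt x t| ≤ C) {η : ℝ → ℝ} (hη : IsCutoff a (a + T) η) (n : ℤ)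
    {t : ℝ} (ht : 0 < t) :
    HasDerivAt (locCoef a T v η n) (locCoef a T vt η n t) t := by
  obtain ⟨K, hK⟩ := hη.exists_bound
  have hpos : ∀ x ∈ uIcc a (a + T), 0 < x := fun x hx => by
    rw [uIcc_of_le (by linarith)] at hx; exact ha.trans_le hx.1
  have hpos' : ∀ x ∈ uIoc a (a + T), 0 < x := fun x hx => hpos x (uIoc_subset_uIcc hx)
  have hcont : ∀ {w : ℝ → ℝ → ℝ}, (∀ t > 0, ContinuousOn (fun x => w x t) (Ioi 0)) → ∀ s > 0,
      ContinuousOn (fun x => fker T n x * ((η x * w x s : ℝ) : ℂ)) (uIcc a (a + T)) := by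
    intro w hw s hs
    have h1 : ContinuousOn (fun x => η x * w x s) (uIcc a (a + T)) :=
      hη.continuous.continuousOn.mul ((hw s hs).mono hpos)
    exact (continuous_fker T n).continuousOn.mul (Complex.continuous_ofReal.comp_continuousOn h1)
  refine (intervalIntegral.hasDerivAt_integral_of_dominated_loc_of_deriv_le
    (bound := fun _ => K * C)
    (F := fun s x => fker T n x * ((η x * v x s : ℝ) : ℂ))
    (F' := fun s x => fker T n x * ((η x * vt x s : ℝ) : ℂ)) (Ioi_mem_nhds ht) ?_ ?_ ?_ ?_
    (by simp) ?_).2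
  · filter_upwards [lt_mem_nhds ht] with s hs
    exact ((hcont hv s hs).mono uIoc_subset_uIcc).aestronglyMeasurable measurableSet_uIoc
  · exact (hcont hv t ht).intervalIntegrable
  · exact ((hcont hvtc t ht).mono uIoc_subset_uIcc).aestronglyMeasurable measurableSet_uIoc
  · refine Eventually.of_forall fun x hx s hs => ?_
    rw [norm_mul, norm_fker, one_mul, Complex.norm_real, Real.norm_eq_abs, abs_mul]
    exact mul_le_mul (hK x) (hb x (hpos' x hx) s hs) (abs_nonneg _) ((abs_nonneg _).trans (hK x))
  · refine Eventually.of_forall fun x hx s hs => ?_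
    exact (((hvt x (hpos' x hx) s hs).const_mul (η x)).ofReal_comp).const_mul _

lemma locCoef_deriv {a T t : ℝ} {v vx : ℝ → ℝ → ℝ}
    (hv : ∀ x, HasDerivAt (fun x => v x t) (vx x t) x)
    (hvx : Continuous fun x => vx x t) {η : ℝ → ℝ} (hη : IsCutoff a (a + T) η) (n : ℤ) :
    locCoef a T vx η n t =
      Complex.I * freq T n * locCoef a T v η n t - locCoef a T v (deriv η) n t := by
  have hcv : Continuous fun x => v x t :=
    continuous_iff_continuousAt.2 fun x => (hv x).continuousAt
  have hc := hη.continuous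
  have hc' := hη.deriv.continuous
  have h := fcoef_deriv (a := a) (T := T) (φ := fun x => ((η x * v x t : ℝ) : ℂ))
    (φ' := fun x => ((deriv η x * v x t + η x * vx x t : ℝ) : ℂ))
    (fun x => ((hη.differentiable x).hasDerivAt.mul (hv x)).ofReal_comp) (by fun_prop)
    (by simp [hη.left_eq_zero]) (by simp [hη.right_eq_zero]) n
  rw [locCoef, locCoef, locCoef, ← h, eq_sub_iff_add_eq, fcoef, fcoef, fcoef,
    ← intervalIntegral.integral_add]
  · congr 1
    ext x
    push_cast
    ring
  all_goals
    refine Continuous.intervalIntegrable ?_ _ _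
    have := continuous_fker T n
    fun_prop

/-- A scalar function `v` solving `v_t = -N + (q / x) v_x + v_xx` on `x, t > 0`, with bounds. -/
structure IsScalarSol (q C : ℝ) (v vx vxx vt N : ℝ → ℝ → ℝ) : Prop where
  deriv_x : ∀ t > 0, ∀ x, HasDerivAt (fun x => v x t) (vx x t) x
  deriv_xx : ∀ t > 0, ∀ x, HasDerivAt (fun x => vx x t) (vxx x t) x
  cont_xx : ∀ t > 0, Continuous fun x => vxx x t
  deriv_t : ∀ x > 0, ∀ t > 0, HasDerivAt (v x) (vt x t) t
  bound : ∀ x > 0, ∀ t > 0, |v x t| ≤ C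
  bound_x : ∀ x > 0, ∀ t > 0, |vx x t| ≤ C
  bound_t : ∀ x > 0, ∀ t > 0, |vt x t| ≤ C
  bound_N : ∀ x > 0, ∀ t > 0, |N x t| ≤ C
  cont_N : ∀ t > 0, Continuous fun x => N x t
  cont_N_t : ∀ x > 0, ContinuousOn (N x) (Ioi 0)
  pde : ∀ x > 0, ∀ t > 0, vt x t = -N x t + q / x * vx x t + vxx x t

section
variable {q C : ℝ} {v vx vxx vt N : ℝ → ℝ → ℝ}

lemma IsScalarSol.cont (h : IsScalarSol q C v vx vxx vt N) {t : ℝ} (ht : 0 < t) :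
    Continuous fun x => v x t :=
  continuous_iff_continuousAt.2 fun x => (h.deriv_x t ht x).continuousAt

lemma IsScalarSol.cont_x (h : IsScalarSol q C v vx vxx vt N) {t : ℝ} (ht : 0 < t) :
    Continuous fun x => vx x t :=
  continuous_iff_continuousAt.2 fun x => (h.deriv_xx t ht x).continuousAt

lemma IsScalarSol.continuousOn_locCoef (h : IsScalarSol q C v vx vxx vt N) {a T : ℝ}
    (ha : 0 < a) (hT : 0 < T) {η : ℝ → ℝ} (hη : IsCutoff a (a + T) η) (n : ℤ) :
    ContinuousOn (locCoef a T v η n) (Ioi 0) :=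
  _root_.continuousOn_locCoef ha hT h.bound (fun _ ht => (h.cont ht).continuousOn)
    (fun x hx t ht => (h.deriv_t x hx t ht).continuousAt.continuousWithinAt) hη n

/-- The source term in the equation for the Fourier modes of the localized solution. -/
def modeSource (a T q : ℝ) (v N : ℝ → ℝ → ℝ) (η : ℝ → ℝ) (n : ℤ) (t : ℝ) : ℂ :=
  locCoef a T v (deriv (deriv η)) n t - locCoef a T v (deriv fun x => η x * (q / x)) n t
    + Complex.I * freq T n * locCoef a T v (fun x => η x * (q / x)) n t
    - 2 * (Complex.I * freq T n) * locCoef a T v (deriv η) n t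
    - locCoef a T N η n t

lemma IsScalarSol.hasDerivAt_locCoef (h : IsScalarSol q C v vx vxx vt N) {a T : ℝ}
    (ha : 0 < a) (hT : 0 < T) {η : ℝ → ℝ} (hη : IsCutoff a (a + T) η) (n : ℤ) {t : ℝ}
    (ht : 0 < t) :
    HasDerivAt (locCoef a T v η n)
      (-(freq T n : ℂ) ^ 2 * locCoef a T v η n t + modeSource a T q v N η n t) t := by
  have hvtc : ∀ t > 0, ContinuousOn (fun x => vt x t) (Ioi 0) := by
    intro t ht
    have h1 : ContinuousOn (fun x => -N x t + q / x * vx x t + vxx x t) (Ioi 0) :=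
      (((h.cont_N t ht).neg.continuousOn).add ((continuousOn_const.div continuousOn_id
        fun x hx => (ne_of_gt hx)).mul (h.cont_x ht).continuousOn)).add (h.cont_xx t ht).continuousOn
    exact h1.congr fun x hx => h.pde x hx t ht
  have key := _root_.hasDerivAt_locCoef ha hT (fun t ht => (h.cont ht).continuousOn) h.deriv_t hvtc
    h.bound_t hη n ht
  convert key using 1
  have e1 := locCoef_deriv (h.deriv_xx t ht) (h.cont_xx t ht) hη n
  have e2 := locCoef_deriv (h.deriv_x t ht) (h.cont_x ht) hη n
  have e3 := locCoef_deriv (h.deriv_x t ht) (h.cont_x ht) hη.deriv n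
  have e4 := locCoef_deriv (h.deriv_x t ht) (h.cont_x ht) (hη.div ha q) n
  have e5 : locCoef a T vt η n t = -locCoef a T N η n t
      + locCoef a T vx (fun x => η x * (q / x)) n t + locCoef a T vxx η n t := by
    have hθ := (hη.div ha q).continuous
    have hcη := hη.continuous
    have hk := continuous_fker T n
    have i1 := h.cont_N t ht
    have i2 := h.cont_x ht
    have i3 := h.cont_xx t ht
    have j1 : Continuous fun x => fker T n x * ((η x * N x t : ℝ) : ℂ) := by fun_prop
    have j2 : Continuous fun x => fker T n x * ((η x * (q / x) * vx x t : ℝ) : ℂ) :=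
      hk.mul (Complex.continuous_ofReal.comp (hθ.mul i2))
    have j3 : Continuous fun x => fker T n x * ((η x * vxx x t : ℝ) : ℂ) := by fun_prop
    rw [locCoef, locCoef, locCoef, locCoef, fcoef, fcoef, fcoef, fcoef,
      ← intervalIntegral.integral_neg, ← intervalIntegral.integral_add
        (j1.fun_neg.intervalIntegrable _ _) (j2.intervalIntegrable _ _),
      ← intervalIntegral.integral_add ((j1.fun_neg.fun_add j2).intervalIntegrable _ _)
        (j3.intervalIntegrable _ _)]
    refine intervalIntegral.integral_congr fun x hx => ?_
    rw [uIcc_of_le (by linarith)] at hx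
    simp only [h.pde x (ha.trans_le hx.1) t ht]
    push_cast
    ring
  rw [e5, e1, e2, e3, e4, modeSource]
  have := Complex.I_sq
  linear_combination (-(freq T n : ℂ) ^ 2 * locCoef a T v η n t) * this
end

lemma IsCutoff.tsupport_mul_subset {a b : ℝ} {η : ℝ → ℝ} (h : IsCutoff a b η) (w : ℝ → ℝ) :
    tsupport (fun x => ((η x * w x : ℝ) : ℂ)) ⊆ Ioo a b := by
  refine (closure_mono fun x hx => ?_).trans h.2
  rw [Function.mem_support] at hx ⊢
  intro h0
  exact hx (by simp [h0])

lemma summable_freq_pow_mul_integral_locCoef {a T K : ℝ} (hT : 0 < T) {w : ℝ → ℝ → ℝ}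
    {η : ℝ → ℝ} (hη : IsCutoff a (a + T) η) {j : ℕ}
    (hc : ∀ n, ContinuousOn (locCoef a T w η n) (Ioi 0))
    (hreg : ∀ t > 0, ContDiff ℝ j (fun x => ((η x * w x t : ℝ) : ℂ)) ∧
      ∀ x, ‖iteratedDeriv j (fun x => ((η x * w x t : ℝ) : ℂ)) x‖ ≤ K)
    {α β : ℝ} (hα : 0 < α) (hαβ : α ≤ β) :
    Summable fun n => freq T n ^ (2 * j) * ∫ t in α..β, ‖locCoef a T w η n t‖ ^ 2 := by
  have hpos : ∀ n : ℤ, 0 ≤ freq T n ^ (2 * j) := fun n => by rw [pow_mul]; positivity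
  have hint : ∀ n, IntervalIntegrable (fun t => freq T n ^ (2 * j) * ‖locCoef a T w η n t‖ ^ 2)
      volume α β := fun n => by
    refine ContinuousOn.intervalIntegrable ?_
    rw [uIcc_of_le hαβ]
    exact continuousOn_const.mul ((((hc n).mono fun t ht => hα.trans_le ht.1).norm).pow 2)
  refine summable_of_sum_le (c := T ^ 2 * K ^ 2 * (β - α)) (fun n => mul_nonneg (hpos n)
    (intervalIntegral.integral_nonneg hαβ fun t _ => by positivity)) fun s => ?_
  calc ∑ n ∈ s, freq T n ^ (2 * j) * ∫ t in α..β, ‖locCoef a T w η n t‖ ^ 2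
      = ∫ t in α..β, ∑ n ∈ s, freq T n ^ (2 * j) * ‖locCoef a T w η n t‖ ^ 2 := by
        rw [intervalIntegral.integral_finsetSum fun n _ => hint n]
        simp only [intervalIntegral.integral_const_mul]
    _ ≤ ∫ t in α..β, T ^ 2 * K ^ 2 := by
        refine intervalIntegral.integral_mono_on hαβ ?_ (by simp) fun t ht => ?_
        · have := IntervalIntegrable.sum s fun n _ => hint n
          rwa [Finset.sum_fn] at this
        · have ht0 := hα.trans_le ht.1
          exact sum_freq_pow_mul_sq_fcoef_le hT (hreg t ht0).1 (hη.tsupport_mul_subset _)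
            (hreg t ht0).2 s
    _ = T ^ 2 * K ^ 2 * (β - α) := by
        rw [intervalIntegral.integral_const, smul_eq_mul, mul_comm]

/-- All localizations of `v` have `m` space derivatives that are square integrable in space-time. -/
def SpectralReg (m : ℕ) (v : ℝ → ℝ → ℝ) : Prop :=
  ∀ a T : ℝ, 0 < a → 0 < T → ∀ η, IsCutoff a (a + T) η → ∀ α β : ℝ, 0 < α → α ≤ β →
    Summable fun n => freq T n ^ (2 * m) * ∫ t in α..β, ‖locCoef a T v η n t‖ ^ 2

/-- All localizations of `w (·, t)` are of class `C^j`, with a bound uniform in time. -/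
def LocBddContDiff (j : ℕ) (w : ℝ → ℝ → ℝ) : Prop :=
  ∀ a T : ℝ, 0 < a → 0 < T → ∀ η, IsCutoff a (a + T) η → ∃ K, ∀ t > 0,
    ContDiff ℝ j (fun x => ((η x * w x t : ℝ) : ℂ)) ∧
      ∀ x, ‖iteratedDeriv j (fun x => ((η x * w x t : ℝ) : ℂ)) x‖ ≤ K

lemma norm_sq_add_five_le {E : Type*} [NormedAddCommGroup E] (x y z w s : E) :
    ‖x - y + z - w - s‖ ^ 2 ≤ 5 * (‖x‖ ^ 2 + ‖y‖ ^ 2 + ‖z‖ ^ 2 + ‖w‖ ^ 2 + ‖s‖ ^ 2) := by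
  have h : ‖x - y + z - w - s‖ ≤ ‖x‖ + ‖y‖ + ‖z‖ + ‖w‖ + ‖s‖ :=
    (norm_sub_le _ _).trans (add_le_add_left ((norm_sub_le _ _).trans (add_le_add_left
      ((norm_add_le _ _).trans (add_le_add_left (norm_sub_le _ _) _)) _)) _)
  refine (pow_le_pow_left₀ (norm_nonneg _) h 2).trans ?_
  nlinarith [sq_nonneg (‖x‖ - ‖y‖), sq_nonneg (‖x‖ - ‖z‖), sq_nonneg (‖x‖ - ‖w‖),
    sq_nonneg (‖x‖ - ‖s‖), sq_nonneg (‖y‖ - ‖z‖), sq_nonneg (‖y‖ - ‖w‖), sq_nonneg (‖y‖ - ‖s‖),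
    sq_nonneg (‖z‖ - ‖w‖), sq_nonneg (‖z‖ - ‖s‖), sq_nonneg (‖w‖ - ‖s‖)]

lemma integral_norm_sq_modeSource_le {a T q : ℝ} {v N : ℝ → ℝ → ℝ} {η : ℝ → ℝ} {n : ℤ}
    {α β : ℝ} (hαβ : α ≤ β)
    (h1 : ContinuousOn (locCoef a T v (deriv (deriv η)) n) (Icc α β))
    (h2 : ContinuousOn (locCoef a T v (deriv fun x => η x * (q / x)) n) (Icc α β))
    (h3 : ContinuousOn (locCoef a T v (fun x => η x * (q / x)) n) (Icc α β))
    (h4 : ContinuousOn (locCoef a T v (deriv η) n) (Icc α β))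
    (h5 : ContinuousOn (locCoef a T N η n) (Icc α β)) :
    ∫ t in α..β, ‖modeSource a T q v N η n t‖ ^ 2 ≤
      5 * ((∫ t in α..β, ‖locCoef a T v (deriv (deriv η)) n t‖ ^ 2)
        + (∫ t in α..β, ‖locCoef a T v (deriv fun x => η x * (q / x)) n t‖ ^ 2)
        + freq T n ^ 2 * (∫ t in α..β, ‖locCoef a T v (fun x => η x * (q / x)) n t‖ ^ 2)
        + 4 * freq T n ^ 2 * (∫ t in α..β, ‖locCoef a T v (deriv η) n t‖ ^ 2)
        + ∫ t in α..β, ‖locCoef a T N η n t‖ ^ 2) := by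
  rw [← uIcc_of_le hαβ] at h1 h2 h3 h4 h5
  have hF : ContinuousOn (modeSource a T q v N η n) (uIcc α β) :=
    (((h1.sub h2).add (continuousOn_const.mul h3)).sub (continuousOn_const.mul h4)).sub h5
  have i1 : IntervalIntegrable (fun t => ‖locCoef a T v (deriv (deriv η)) n t‖ ^ 2)
    volume α β := (h1.norm.pow 2).intervalIntegrable
  have i2 : IntervalIntegrable
    (fun t => ‖locCoef a T v (deriv fun x => η x * (q / x)) n t‖ ^ 2) volume α β :=
    (h2.norm.pow 2).intervalIntegrable
  have i3 : IntervalIntegrable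
    (fun t => freq T n ^ 2 * ‖locCoef a T v (fun x => η x * (q / x)) n t‖ ^ 2) volume α β :=
    (h3.norm.pow 2).intervalIntegrable.const_mul _
  have i4 : IntervalIntegrable
    (fun t => 4 * freq T n ^ 2 * ‖locCoef a T v (deriv η) n t‖ ^ 2) volume α β :=
    (h4.norm.pow 2).intervalIntegrable.const_mul _
  have i5 : IntervalIntegrable (fun t => ‖locCoef a T N η n t‖ ^ 2) volume α β :=
    (h5.norm.pow 2).intervalIntegrable
  rw [← intervalIntegral.integral_const_mul (freq T n ^ 2),
    ← intervalIntegral.integral_const_mul (4 * freq T n ^ 2),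
    ← intervalIntegral.integral_add i1 i2, ← intervalIntegral.integral_add (i1.add i2) i3,
    ← intervalIntegral.integral_add ((i1.add i2).add i3) i4,
    ← intervalIntegral.integral_add (((i1.add i2).add i3).add i4) i5,
    ← intervalIntegral.integral_const_mul]
  refine intervalIntegral.integral_mono_on hαβ (hF.norm.pow 2).intervalIntegrable
    (((((i1.add i2).add i3).add i4).add i5).const_mul 5) fun t _ => ?_
  refine (norm_sq_add_five_le _ _ _ _ _).trans (le_of_eq ?_)
  simp only [norm_mul, Complex.norm_I, Complex.norm_real, Real.norm_eq_abs, mul_pow, sq_abs]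
  norm_num

lemma IsScalarSol.spectralReg_succ {q C : ℝ} {v vx vxx vt N : ℝ → ℝ → ℝ}
    (h : IsScalarSol q C v vx vxx vt N) {m : ℕ} (hm : SpectralReg (m + 1) v)
    (hN : LocBddContDiff m N) : SpectralReg (m + 2) v := by
  intro a T ha hT η hη α β hα hαβ
  have hα' : 0 < α / 2 := half_pos hα
  have hαβ' : α / 2 ≤ β := by linarith
  have hβ : 0 < β := hα.trans_le hαβ
  obtain ⟨K, hK⟩ := hN a T ha hT η hη
  have hNc := fun n => _root_.continuousOn_locCoef ha hT h.bound_N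
    (fun t ht => (h.cont_N t ht).continuousOn) h.cont_N_t hη n
  have sN := summable_freq_pow_mul_integral_locCoef hT hη hNc hK hα' hαβ'
  have c0 := fun n => h.continuousOn_locCoef ha hT hη n
  have c1 := fun n => h.continuousOn_locCoef ha hT hη.deriv.deriv n
  have c2 := fun n => h.continuousOn_locCoef ha hT (hη.div ha q).deriv n
  have c3 := fun n => h.continuousOn_locCoef ha hT (hη.div ha q) n
  have c4 := fun n => h.continuousOn_locCoef ha hT hη.deriv n
  have s0 := hm a T ha hT η hη (α / 2) β hα' hαβ'
  have s1 := hm a T ha hT _ hη.deriv.deriv (α / 2) β hα' hαβ'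
  have s2 := hm a T ha hT _ (hη.div ha q).deriv (α / 2) β hα' hαβ'
  have s3 := hm a T ha hT _ (hη.div ha q) (α / 2) β hα' hαβ'
  have s4 := hm a T ha hT _ hη.deriv (α / 2) β hα' hαβ'
  have nn : ∀ (w : ℝ → ℝ → ℝ) (ζ : ℝ → ℝ) (n : ℤ),
      0 ≤ ∫ t in (α / 2)..β, ‖locCoef a T w ζ n t‖ ^ 2 := fun w ζ n =>
    intervalIntegral.integral_nonneg hαβ' fun t _ => by positivity
  have s1' := s1.freq_pow_mono hT (nn v _)
  have s2' := s2.freq_pow_mono hT (nn v _)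
  have S := (s0.add (((((s1'.add s2').add s3).add (s4.mul_left 4)).add sN).mul_left
    (β * 5))).mul_left (2 / α)
  refine Summable.of_norm_bounded_eventually S ?_
  filter_upwards [eventually_cofinite_ne_zero] with n hn
  have hl := freq_ne_zero hT hn
  have hsub : Icc (α / 2) β ⊆ Ioi 0 := fun t ht => hα'.trans_le ht.1
  have hF := integral_norm_sq_modeSource_le (q := q) (N := N) hαβ' ((c1 n).mono hsub)
    ((c2 n).mono hsub) ((c3 n).mono hsub) ((c4 n).mono hsub) ((hNc n).mono hsub)
  have hE := energy_mode_le hl hα hαβ (fun t ht => h.hasDerivAt_locCoef ha hT hη n ht)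
    ((((c1 n).sub (c2 n)).add (continuousOn_const.mul (c3 n))).sub
      (continuousOn_const.mul (c4 n)) |>.sub (hNc n))
  have nn' : 0 ≤ ∫ t in α..β, ‖locCoef a T v η n t‖ ^ 2 :=
    intervalIntegral.integral_nonneg hαβ fun t _ => by positivity
  rw [Real.norm_of_nonneg (mul_nonneg (by rw [pow_mul]; positivity) nn')]
  generalize (∫ t in α..β, ‖locCoef a T v η n t‖ ^ 2) = I at hE nn' ⊢
  generalize (∫ t in (α / 2)..β, ‖locCoef a T v η n t‖ ^ 2) = J0 at hE ⊢
  generalize (∫ t in (α / 2)..β, ‖locCoef a T v (deriv (deriv η)) n t‖ ^ 2) = J1 at hF ⊢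
  generalize (∫ t in (α / 2)..β,
    ‖locCoef a T v (deriv fun x => η x * (q / x)) n t‖ ^ 2) = J2 at hF ⊢
  generalize (∫ t in (α / 2)..β,
    ‖locCoef a T v (fun x => η x * (q / x)) n t‖ ^ 2) = J3 at hF ⊢
  generalize (∫ t in (α / 2)..β, ‖locCoef a T v (deriv η) n t‖ ^ 2) = J4 at hF ⊢
  generalize (∫ t in (α / 2)..β, ‖locCoef a T N η n t‖ ^ 2) = J5 at hF ⊢
  change _ ≤ _ + β * ((freq T n ^ 2)⁻¹ * ∫ t in (α / 2)..β, ‖modeSource a T q v N η n t‖ ^ 2) at hE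
  generalize (∫ t in (α / 2)..β, ‖modeSource a T q v N η n t‖ ^ 2) = JF at hF hE
  generalize freq T n = l at *
  have hl2 : 0 < l ^ 2 := by positivity
  have hlm : 0 ≤ l ^ (2 * m) := by rw [pow_mul]; positivity
  have e1 : l ^ 2 * ((α / 2) * I) ≤ J0 + β * ((l ^ 2)⁻¹ *
      (5 * (J1 + J2 + l ^ 2 * J3 + 4 * l ^ 2 * J4 + J5))) := by
    refine hE.trans ?_
    gcongr
  have e2 := mul_le_mul_of_nonneg_left e1 (mul_nonneg (mul_nonneg (by positivity : 0 ≤ 2 / α) hlm)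
    hl2.le)
  refine le_trans (le_of_eq ?_) (e2.trans (le_of_eq ?_))
  · field_simp
    ring
  · field_simp
    ring

lemma exists_common_bound {ι : Type*} {j : ℕ} {f : ℕ → ι → ℝ}
    (h : ∀ i ≤ j, ∃ K, ∀ y, f i y ≤ K) : ∃ K, 0 ≤ K ∧ ∀ i ≤ j, ∀ y, f i y ≤ K := by
  choose! K hK using h
  refine ⟨∑ i ∈ Finset.range (j + 1), |K i|, Finset.sum_nonneg fun _ _ => abs_nonneg _,
    fun i hi y => ((hK i hi y).trans (le_abs_self _)).trans ?_⟩
  exact Finset.single_le_sum (f := fun i => |K i|) (fun _ _ => abs_nonneg _)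
    (Finset.mem_range.2 (by omega))

lemma IsCutoff.iteratedDeriv {a b : ℝ} {η : ℝ → ℝ} (h : IsCutoff a b η) (i : ℕ) :
    IsCutoff a b (iteratedDeriv i η) := by
  induction i with
  | zero => simpa using h
  | succ i ih => rw [iteratedDeriv_succ]; exact ih.deriv

lemma norm_iteratedFDerivWithin_Ioi {E : Type*} [NormedAddCommGroup E] [NormedSpace ℝ E]
    (φ : ℝ → E) (i : ℕ) {x : ℝ} (hx : 0 < x) :
    ‖iteratedFDerivWithin ℝ i φ (Ioi 0) x‖ = ‖iteratedDeriv i φ x‖ := by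
  rw [norm_iteratedFDerivWithin_eq_norm_iteratedDerivWithin,
    iteratedDerivWithin_of_isOpen isOpen_Ioi hx]

lemma exists_norm_iteratedDeriv_comp_le {E F : Type*} [NormedAddCommGroup E] [NormedSpace ℝ E]
    [ProperSpace E] [NormedAddCommGroup F] [NormedSpace ℝ F] {G : E → F} {j : ℕ}
    (hG : ContDiff ℝ j G) (C : ℝ) :
    ∃ K, ∀ φ : ℝ → E, ContDiffOn ℝ j φ (Ioi 0) →
      (∀ i ≤ j, ∀ x > 0, ‖iteratedDeriv i φ x‖ ≤ C) →
      ∀ i ≤ j, ∀ x > 0, ‖iteratedDeriv i (fun x => G (φ x)) x‖ ≤ K := by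
  have h1 : ∀ i ≤ j, ∃ K, ∀ y : Metric.closedBall (0 : E) C, ‖iteratedFDeriv ℝ i G y‖ ≤ K := by
    intro i hi
    obtain ⟨K, hK⟩ := (isCompact_closedBall (0 : E) C).exists_bound_of_continuousOn
      (hG.continuous_iteratedFDeriv (m := i) (by exact_mod_cast hi)).continuousOn
    exact ⟨K, fun y => hK y y.2⟩
  obtain ⟨K, hK0, hK⟩ := exists_common_bound h1
  refine ⟨j.factorial * K * (max 1 C) ^ j, fun φ hφ hb i hi x hx => ?_⟩
  rw [← norm_iteratedFDerivWithin_Ioi _ _ hx]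
  have hij : ((i : ℕ) : WithTop ℕ∞) ≤ j := by exact_mod_cast hi
  refine (norm_iteratedFDerivWithin_comp_le (t := univ) (hG.contDiffOn.of_le hij) (hφ.of_le hij)
    le_rfl uniqueDiffOn_univ isOpen_Ioi.uniqueDiffOn (mapsTo_univ _ _) hx (C := K)
    (D := max 1 C) ?_ ?_).trans ?_
  · intro l hl
    rw [iteratedFDerivWithin_univ]
    refine hK l (hl.trans hi) ⟨φ x, ?_⟩
    simpa using hb 0 (by omega) x hx
  · intro l hl hli
    rw [norm_iteratedFDerivWithin_Ioi _ _ hx]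
    exact ((hb l (hli.trans hi) x hx).trans (le_max_right _ _)).trans
      (le_self_pow₀ (le_max_left _ _) (by omega))
  · gcongr
    exact le_max_left _ _

lemma locBddContDiff_comp {E : Type*} [NormedAddCommGroup E] [NormedSpace ℝ E]
    [ProperSpace E] {G : E → ℝ} {j : ℕ} (hG : ContDiff ℝ j G) {u : ℝ → ℝ → E} {C : ℝ}
    (hu : ∀ t > 0, ContDiffOn ℝ j (fun x => u x t) (Ioi 0))
    (hb : ∀ t > 0, ∀ i ≤ j, ∀ x > 0, ‖iteratedDeriv i (fun x => u x t) x‖ ≤ C) :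
    LocBddContDiff j fun x t => G (u x t) := by
  intro a T ha hT η hη
  obtain ⟨K, hK⟩ := exists_norm_iteratedDeriv_comp_le hG C
  obtain ⟨M, hM0, hM⟩ := exists_common_bound (j := j) (f := fun i x => ‖iteratedDeriv i η x‖)
    fun i _ => (hη.iteratedDeriv i).exists_bound
  refine ⟨∑ i ∈ Finset.range (j + 1), (j.choose i) * M * K, fun t ht => ?_⟩
  have hs : tsupport (fun x => η x * G (u x t)) ⊆ Ioo a (a + T) :=
    tsupport_mul_subset_left.trans hη.2
  have hIoo : Ioo a (a + T) ⊆ Ioi 0 := fun x hx => ha.trans hx.1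
  have hGu : ContDiffOn ℝ j (fun x => G (u x t)) (Ioi 0) := hG.comp_contDiffOn (hu t ht)
  have hc : ContDiff ℝ j fun x => η x * G (u x t) :=
    contDiff_of_tsupport_subset_of_contDiffOn isOpen_Ioo hs
      ((hη.1 j).contDiffOn.mul (hGu.mono hIoo))
  refine ⟨Complex.ofRealCLM.contDiff.comp hc, fun x => ?_⟩
  have e : ‖iteratedDeriv j (fun x => ((η x * G (u x t) : ℝ) : ℂ)) x‖ =
      ‖iteratedDeriv j (fun x => η x * G (u x t)) x‖ := by
    rw [← norm_iteratedFDeriv_eq_norm_iteratedDeriv, ← norm_iteratedFDeriv_eq_norm_iteratedDeriv]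
    exact Complex.ofRealLI.norm_iteratedFDeriv_comp_left hc.contDiffAt le_rfl
  rw [e]
  have hK' := hK _ (hu t ht) (hb t ht)
  have hK0 : 0 ≤ K := (norm_nonneg _).trans (hK' 0 (by omega) 1 one_pos)
  rcases le_or_gt x 0 with hx | hx
  · have : iteratedDeriv j (fun x => η x * G (u x t)) x = 0 :=
      eq_zero_of_tsupport_subset ((tsupport_iteratedDeriv_subset _ j).trans (hs.trans hIoo))
        (by simpa using hx)
    rw [this, norm_zero]
    positivity
  · rw [← norm_iteratedFDerivWithin_Ioi _ _ hx]
    refine (norm_iteratedFDerivWithin_mul_le (hη.1 j).contDiffOn hGu isOpen_Ioi.uniqueDiffOn hx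
      le_rfl).trans (Finset.sum_le_sum fun i hi => ?_)
    rw [norm_iteratedFDerivWithin_Ioi _ _ hx, norm_iteratedFDerivWithin_Ioi _ _ hx]
    have := Finset.mem_range.1 hi
    gcongr
    · exact hM i (by omega) x
    · exact hK' (j - i) (by omega) x hx

lemma exists_isCutoff_eq_one {x y : ℝ} (hx : 0 < x) (hxy : x < y) :
    ∃ η, IsCutoff (x / 2) (x / 2 + y) η ∧ ∀ z ∈ Icc x y, η z = 1 := by
  let f : ContDiffBump ((x + y) / 2) :=
    { rIn := (y - x) / 2
      rOut := (y - x) / 2 + x / 3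
      rIn_pos := by linarith
      rIn_lt_rOut := by linarith }
  refine ⟨f, ⟨fun m => f.contDiff, ?_⟩, fun z hz => f.one_of_mem_closedBall ?_⟩
  · rw [f.tsupport_eq, Real.closedBall_eq_Icc]
    intro z hz
    have h1 : (x + y) / 2 - ((y - x) / 2 + x / 3) ≤ z := hz.1
    have h2 : z ≤ (x + y) / 2 + ((y - x) / 2 + x / 3) := hz.2
    constructor <;> linarith
  · rw [Real.closedBall_eq_Icc]
    change z ∈ Icc ((x + y) / 2 - (y - x) / 2) ((x + y) / 2 + (y - x) / 2)
    constructor <;> linarith [hz.1, hz.2]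

lemma ContinuousLinearMap.iteratedDeriv_comp_left {E F : Type*} [NormedAddCommGroup E]
    [NormedSpace ℝ E] [NormedAddCommGroup F] [NormedSpace ℝ F] (L : E →L[ℝ] F) {f : ℝ → E}
    {m : ℕ} {x : ℝ} (hf : ContDiffAt ℝ m f x) :
    iteratedDeriv m (fun y => L (f y)) x = L (iteratedDeriv m f x) := by
  have := L.iteratedFDeriv_comp_left hf le_rfl
  rw [iteratedDeriv_eq_iteratedFDeriv, iteratedDeriv_eq_iteratedFDeriv]
  exact congrArg (fun A => A fun _ => 1) this

lemma contDiffOn_and_lipschitz_of_summable_locCoef {n m : ℕ} {u : ℝ → ℝ → Euc n} {t x y C : ℝ}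
    (hu : Continuous fun s => u s t)
    (hx : 0 < x) (hxy : x < y) {η : ℝ → ℝ} (hη : IsCutoff (x / 2) (x / 2 + y) η)
    (hη1 : ∀ z ∈ Icc x y, η z = 1)
    (hs : ∀ i, Summable fun l : ℤ => freq y l ^ (2 * (m + 1)) *
      ‖locCoef (x / 2) y (fun s t => u s t i) η l t‖ ^ 2)
    (hC : ∀ z, ‖iteratedDeriv (m + 1) (fun s => u s t) z‖ ≤ C) :
    ContDiffOn ℝ m (fun s => u s t) (Ioo x y) ∧ ∀ z ∈ Ioo x y, ∀ w ∈ Ioo x y, z ≤ w →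
      ‖iteratedDeriv m (fun s => u s t) w - iteratedDeriv m (fun s => u s t) z‖ ≤
        C * (w - z) := by
  have hy : 0 < y := hx.trans hxy
  have hηc := hη.continuous
  have hR := fun i => contDiff_of_summable_freq hy m
    (φ := fun s => ((η s * u s t i : ℝ) : ℂ)) (by fun_prop) (hη.tsupport_mul_subset _) (hs i)
  choose hcd g hgi hg using hR
  have heq : ∀ i, ∀ z ∈ Ioo x y, u z t i = Complex.reCLM ((η z * u z t i : ℝ) : ℂ) := by
    intro i z hz
    simp [hη1 z (Ioo_subset_Icc_self hz)]
  have hcu : ContDiffOn ℝ m (fun s => u s t) (Ioo x y) := contDiffOn_euclidean.2 fun i =>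
    (Complex.reCLM.contDiff.comp (hcd i)).contDiffOn.congr (heq i)
  have hder : ∀ i, ∀ z ∈ Ioo x y, iteratedDeriv m (fun s => u s t) z i =
      (iteratedDeriv m (fun s => ((η s * u s t i : ℝ) : ℂ)) z).re := by
    intro i z hz
    have hn := isOpen_Ioo.mem_nhds hz
    have e1 := (EuclideanSpace.proj (𝕜 := ℝ) i).iteratedDeriv_comp_left
      ((hcu z hz).contDiffAt hn)
    have e2 := Complex.reCLM.iteratedDeriv_comp_left (hcd i).contDiffAt (x := z)
    have e3 : (fun s => u s t i) =ᶠ[𝓝 z] fun s => Complex.reCLM ((η s * u s t i : ℝ) : ℂ) := by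
      filter_upwards [hn] with s hs using heq i s hs
    have e4 := e3.iteratedDeriv_eq m
    rw [e2] at e4
    exact e1.symm.trans e4
  refine ⟨hcu, fun z hz w hw hzw => ?_⟩
  have hmem : ∀ s ∈ Icc z w, s ∈ Ioo x y ∧ s ∈ Ioc (x / 2) (x / 2 + y) := fun s hs =>
    ⟨⟨hz.1.trans_le hs.1, hs.2.trans_lt hw.2⟩, by linarith [hz.1, hs.1], by linarith [hw.2, hs.2]⟩
  have hgi' : ∀ i, ∀ s ∈ Icc z w, IntervalIntegrable (g i) volume z s := fun i s hs =>
    (hgi i).mono_set (by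
      rw [uIcc_of_le hs.1, uIcc_of_le (by linarith)]
      exact Icc_subset_Icc (hmem z (left_mem_Icc.2 hzw)).2.1.le (hmem s hs).2.2)
  refine norm_sub_le_of_eq_integral_of_norm_deriv_le (g := fun i s => (g i s).re) hzw
    (fun i => ?_) (fun i s hs => ?_) (fun s _ => ?_)
  · have := hgi' i w (right_mem_Icc.2 hzw)
    exact ⟨Complex.reCLM.integrable_comp this.1, Complex.reCLM.integrable_comp this.2⟩
  · have h1 := Complex.reCLM.intervalIntegral_comp_comm (hgi' i s hs)
    rw [hder i s (hmem s hs).1, hder i z hz]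
    have h2 := hg i z (hmem z (left_mem_Icc.2 hzw)).2 s (hmem s hs).2 hs.1
    rw [← h2] at h1
    simp only [Complex.reCLM_apply, Complex.sub_re] at h1
    rw [h1]
    ring
  · rw [← iteratedDeriv_succ]
    exact hC s

lemma exists_nat_mem_Ioo {x y : ℝ} (hx : 0 < x) (hy : 0 < y) :
    ∃ N : ℕ, x ∈ Ioo ((1 : ℝ) / (N + 2)) (N + 2) ∧ y ∈ Ioo ((1 : ℝ) / (N + 2)) (N + 2) := by
  obtain ⟨N, hN⟩ := exists_nat_gt (x + y + 1 / x + 1 / y)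
  have h1 : 0 < 1 / x := by positivity
  have h2 : 0 < 1 / y := by positivity
  refine ⟨N, ⟨?_, by linarith⟩, ⟨?_, by linarith⟩⟩
  · rw [one_div_lt (by positivity) hx]; linarith
  · rw [one_div_lt (by positivity) hy]; linarith

lemma bddLip_of_spectralReg {n m : ℕ} {u : ℝ → ℝ → Euc n} {C : ℝ}
    (hux : ∀ t > 0, Continuous fun s => u s t)
    (hut : ∀ x > 0, ContinuousOn (u x) (Ioi 0))
    (hC : ∀ t > 0, ∀ j ≤ m + 1, ∀ r, ‖iteratedDeriv j (fun s => u s t) r‖ ≤ C)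
    (hS : ∀ i, SpectralReg (m + 1) fun s t => u s t i) {t : ℝ} (ht : 0 < t) :
    BddLip m C fun s => u s t := by
  have hN : ∀ N : ℕ, (0 : ℝ) < 1 / (N + 2) ∧ (1 : ℝ) / (N + 2) < N + 2 := fun N => by
    refine ⟨by positivity, ?_⟩
    rw [div_lt_iff₀ (by positivity)]
    have : (0 : ℝ) ≤ N := N.cast_nonneg
    nlinarith
  choose η hη hη1 using fun N : ℕ => exists_isCutoff_eq_one (hN N).1 (hN N).2
  have hgood : ∀ p : ℕ, ∃ s ∈ Ioc t (t + 1 / ((p : ℝ) + 1)), BddLip m C fun r => u r s := by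
    intro p
    have hp : (0 : ℝ) < 1 / ((p : ℝ) + 1) := by positivity
    have hle : t ≤ t + 1 / ((p : ℝ) + 1) := by linarith
    have hae : ∀ᵐ s ∂(volume.restrict (Ioc t (t + 1 / ((p : ℝ) + 1)))), ∀ N : ℕ, ∀ i : Fin n,
        Summable fun l : ℤ => freq ((N : ℝ) + 2) l ^ (2 * (m + 1)) *
          ‖locCoef (1 / ((N : ℝ) + 2) / 2) ((N : ℝ) + 2) (fun s t => u s t i) (η N) l s‖ ^ 2 := by
      refine ae_all_iff.2 fun N => ae_all_iff.2 fun i => ?_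
      have ha : (0 : ℝ) < 1 / ((N : ℝ) + 2) / 2 := half_pos (hN N).1
      have hT : (0 : ℝ) < (N : ℝ) + 2 := by positivity
      refine ae_summable_of_summable_integral hle (fun l => by rw [pow_mul]; positivity)
        (fun l s => by positivity) (fun l => ?_) (hS i _ _ ha hT _ (hη N) t _ ht hle)
      have hc : ContinuousOn (locCoef (1 / ((N : ℝ) + 2) / 2) ((N : ℝ) + 2)
          (fun s t => u s t i) (η N) l) (Ioi 0) := by
        refine continuousOn_locCoef (C := C) ha hT (fun x _ s hs => ?_) (fun s hs => ?_)
          (fun x hx => ?_) (hη N) l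
        · exact (PiLp.norm_apply_le (u x s) i).trans (by simpa using hC s hs 0 (by omega) x)
        · have := hux s hs
          exact Continuous.continuousOn (by fun_prop)
        · have := hut x hx
          fun_prop
      exact (hc.mono fun s hs => ht.trans_le hs.1).norm.pow 2
    have hne : (ae (volume.restrict (Ioc t (t + 1 / ((p : ℝ) + 1))))).NeBot := by
      rw [ae_restrict_neBot, Real.volume_Ioc]
      simpa using by positivity
    obtain ⟨s, hs, hsI⟩ := (hae.and (ae_restrict_mem measurableSet_Ioc)).exists
    have hs0 : 0 < s := ht.trans hsI.1
    have key := fun N => contDiffOn_and_lipschitz_of_summable_locCoef (hux s hs0) (hN N).1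
      (hN N).2 (hη N) (hη1 N) (hs N) (hC s hs0 (m + 1) le_rfl)
    refine ⟨s, hsI, fun x hx => ?_, fun j hj x _ => hC s hs0 j (by omega) x,
      fun x hx y hy => ?_⟩
    · obtain ⟨N, hxN, -⟩ := exists_nat_mem_Ioo hx hx
      exact (((key N).1 x hxN).contDiffAt (isOpen_Ioo.mem_nhds hxN)).contDiffWithinAt
    · obtain ⟨N, hxN, hyN⟩ := exists_nat_mem_Ioo hx hy
      rcases le_total x y with hxy | hxy
      · rw [norm_sub_rev, abs_sub_comm, abs_of_nonneg (sub_nonneg.2 hxy)]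
        exact (key N).2 x hxN y hyN hxy
      · rw [abs_of_nonneg (sub_nonneg.2 hxy)]
        exact (key N).2 y hyN x hxN hxy
  choose s hsI hs using hgood
  refine BddLip.of_tendsto hs fun x hx => ?_
  have hst : Tendsto s atTop (𝓝 t) := by
    refine tendsto_of_tendsto_of_tendsto_of_le_of_le tendsto_const_nhds
      (h := fun p : ℕ => t + 1 / ((p : ℝ) + 1)) ?_ (fun p => (hsI p).1.le) (fun p => (hsI p).2)
    simpa using tendsto_one_div_add_atTop_nhds_zero_nat.const_add t
  exact ((hut x hx).continuousAt (Ioi_mem_nhds ht)).tendsto.comp hst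

lemma ContDiff.gradient {n k : ℕ} {V : Euc n → ℝ} (hV : ContDiff ℝ (k + 1 : ℕ) V) :
    ContDiff ℝ k (gradient V) := by
  have h : ContDiff ℝ k (fderiv ℝ V) := hV.fderiv_right (by norm_cast)
  exact (InnerProductSpace.toDual ℝ (Euc n)).symm.contDiff.comp h

namespace IsRadialSolution

variable {n d k : ℕ} {V : Euc n → ℝ} {u : ℝ → ℝ → Euc n} {C : ℝ}

lemma hasDerivAt_r (hu : IsRadialSolution d V u) {t : ℝ} (ht : 0 < t) (r : ℝ) :
    HasDerivAt (fun s => u s t) (ur u r t) r :=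
  (hu.diff_r t ht r).hasDerivAt

lemma hasDerivAt_rr (hu : IsRadialSolution d V u) {t : ℝ} (ht : 0 < t) (r : ℝ) :
    HasDerivAt (fun s => ur u s t) (urr u r t) r :=
  (hu.diff_rr t ht r).hasDerivAt

lemma continuous_r (hu : IsRadialSolution d V u) {t : ℝ} (ht : 0 < t) :
    Continuous fun s => u s t :=
  continuous_iff_continuousAt.2 fun r => (hu.diff_r t ht r).continuousAt

lemma continuousOn_t (hu : IsRadialSolution d V u) (r : ℝ) :
    ContinuousOn (u r) (Ioi 0) :=
  fun t ht => (hu.diff_t t ht r).continuousAt.continuousWithinAt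

lemma contDiff_one_r (hu : IsRadialSolution d V u) {t : ℝ} (ht : 0 < t) :
    ContDiff ℝ 1 fun s => u s t :=
  contDiff_one_iff_deriv.2 ⟨fun r => hu.diff_r t ht r,
    continuous_iff_continuousAt.2 fun r => (hu.diff_rr t ht r).continuousAt⟩

lemma exists_isScalarSol (hu : IsRadialSolution d V u) (hV : Continuous (gradient V)) :
    ∃ C, ∀ i, IsScalarSol ((d : ℝ) - 1) C (fun r t => u r t i) (fun r t => ur u r t i)
      (fun r t => urr u r t i) (fun r t => ut u r t i) (fun r t => gradient V (u r t) i) := by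
  obtain ⟨C, hC⟩ := hu.bounded
  obtain ⟨K, hK⟩ := (isCompact_closedBall (0 : Euc n) C).exists_bound_of_continuousOn
    hV.continuousOn
  have hb : ∀ x > 0, ∀ t > 0, ‖u x t‖ ≤ C ∧ ‖ur u x t‖ ≤ C ∧ ‖ut u x t‖ ≤ C := by
    intro x hx t ht
    have := hC x t (le_of_lt hx) ht
    have h1 := norm_nonneg (u x t)
    have h2 := norm_nonneg (ur u x t)
    have h3 := norm_nonneg (urr u x t)
    have h4 := norm_nonneg (ut u x t)
    exact ⟨by linarith, by linarith, by linarith⟩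
  have hproj : ∀ (i : Fin n) {f : ℝ → Euc n} {f' : Euc n} {x : ℝ}, HasDerivAt f f' x →
      HasDerivAt (fun y => f y i) (f' i) x := fun i f f' x h =>
    (EuclideanSpace.proj (𝕜 := ℝ) i).hasFDerivAt.comp_hasDerivAt x h
  have habs : ∀ (x : Euc n) (i : Fin n), |x i| ≤ ‖x‖ := fun x i => PiLp.norm_apply_le x i
  refine ⟨max C K, fun i => ⟨fun t ht x => hproj i (hu.hasDerivAt_r ht x),
    fun t ht x => hproj i (hu.hasDerivAt_rr ht x), fun t ht => ?_,
    fun x _ t ht => hproj i (hu.diff_t t ht x).hasDerivAt,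
    fun x hx t ht => (habs _ i).trans ((hb x hx t ht).1.trans (le_max_left _ _)),
    fun x hx t ht => (habs _ i).trans ((hb x hx t ht).2.1.trans (le_max_left _ _)),
    fun x hx t ht => (habs _ i).trans ((hb x hx t ht).2.2.trans (le_max_left _ _)),
    fun x hx t ht => (habs _ i).trans ((hK _ ?_).trans (le_max_right _ _)),
    fun t ht => ?_, fun x _ => ?_, fun x hx t ht => ?_⟩⟩
  · have := hu.cont_rr t ht
    fun_prop
  · simpa using (hb x hx t ht).1
  · have := hV.comp (hu.continuous_r ht)
    exact (EuclideanSpace.proj (𝕜 := ℝ) i).continuous.comp this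
  · have := hV.comp_continuousOn (hu.continuousOn_t x)
    exact (EuclideanSpace.proj (𝕜 := ℝ) i).continuous.comp_continuousOn this
  · simp [hu.pde x hx t ht]

lemma spectralReg (hu : IsRadialSolution d V u) (hV : ContDiff ℝ (k + 1 : ℕ) V)
    (hC : ∀ t > (0:ℝ), ∀ j ≤ k + 2, ∀ r : ℝ, ‖iteratedDeriv j (fun s => u s t) r‖ ≤ C) :
    ∀ m ≤ k + 1, ∀ i, SpectralReg (m + 1) fun s t => u s t i := by
  have hgrad : ContDiff ℝ k (gradient V) := hV.gradient
  obtain ⟨K, hK⟩ := hu.exists_isScalarSol hgrad.continuous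
  intro m
  induction m with
  | zero =>
    intro _ i a T ha hT η hη α β hα hαβ
    have hl : LocBddContDiff 1 fun s t => u s t i :=
      locBddContDiff_comp (G := fun x : Euc n => x i) (C := C)
        (EuclideanSpace.proj (𝕜 := ℝ) i).contDiff
        (fun t ht => (hu.contDiff_one_r ht).contDiffOn)
        (fun t ht j hj x _ => hC t ht j (by omega) x)
    obtain ⟨M, hM⟩ := hl a T ha hT η hη
    exact summable_freq_pow_mul_integral_locCoef hT hη
      (fun l => (hK i).continuousOn_locCoef ha hT hη l) hM hα hαβ
  | succ m ih =>
    intro hm i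
    have hS := ih (by omega)
    have hA : ∀ t > 0, BddLip m C fun s => u s t := fun t ht =>
      bddLip_of_spectralReg (fun t ht => hu.continuous_r ht) (fun x _ => hu.continuousOn_t x)
        (fun t ht j hj r => hC t ht j (by omega) r) hS ht
    have hm' : ((m : ℕ) : WithTop ℕ∞) ≤ k := by exact_mod_cast (by omega : m ≤ k)
    refine (hK i).spectralReg_succ (hS i) (locBddContDiff_comp
      (G := fun x : Euc n => gradient V x i) ?_ (fun t ht => (hA t ht).1)
      (fun t ht => (hA t ht).2.1))
    exact (EuclideanSpace.proj (𝕜 := ℝ) i).contDiff.comp (hgrad.of_le hm')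

/-- Parabolic smoothing: the profiles of `u` are as regular as the bounds suggest. -/
lemma bddLip (hu : IsRadialSolution d V u) (hV : ContDiff ℝ (k + 1 : ℕ) V)
    (hC : ∀ t > (0:ℝ), ∀ j ≤ k + 2, ∀ r : ℝ, ‖iteratedDeriv j (fun s => u s t) r‖ ≤ C)
    {t : ℝ} (ht : 0 < t) : BddLip (k + 1) C fun s => u s t :=
  bddLip_of_spectralReg (fun _ ht => hu.continuous_r ht) (fun x _ => hu.continuousOn_t x)
    hC (hu.spectralReg hV hC (k + 1) le_rfl) ht

lemma bddLip_ut {C' : ℝ} (hu : IsRadialSolution d V u) (hV : ContDiff ℝ (k + 2 : ℕ) V)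
    {t : ℝ} (ht : 0 < t) (hB : BddLip (k + 2) C fun s => u s t)
    (hC' : ∀ j ≤ k + 1, ∀ r : ℝ, ‖iteratedDeriv j (fun s => ut u s t) r‖ ≤ C') :
    BddLip k C' fun s => ut u s t := by
  have hgrad : ContDiff ℝ (k + 1 : ℕ) (gradient V) := hV.gradient
  have h0 : ContDiffOn ℝ (k + 2 : ℕ) (fun s => u s t) (Ioi 0) := hB.1
  have h1 : ContDiffOn ℝ (k + 1 : ℕ) (fun s => ur u s t) (Ioi 0) :=
    h0.deriv_of_isOpen isOpen_Ioi (by norm_cast)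
  have h2 : ContDiffOn ℝ k (fun s => urr u s t) (Ioi 0) :=
    h1.deriv_of_isOpen isOpen_Ioi (by norm_cast)
  have hf : ContDiffOn ℝ (k + 1 : ℕ)
      (fun r => -gradient V (u r t) + (((d : ℝ) - 1) / r) • ur u r t) (Ioi 0) := by
    refine ContDiffOn.add (ContDiffOn.neg ?_) (ContDiffOn.fun_smul ?_ h1)
    · exact hgrad.comp_contDiffOn (h0.of_le (by norm_cast; omega))
    · exact contDiffOn_const.div contDiffOn_id fun x hx => ne_of_gt hx
  set f := fun r => -gradient V (u r t) + (((d : ℝ) - 1) / r) • ur u r t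
  have hf' : ContDiffOn ℝ k f (Ioi 0) := hf.of_le (by norm_cast; omega)
  have heq : ∀ r ∈ Ioi (0 : ℝ), ut u r t = f r + urr u r t := fun r hr => hu.pde r hr t ht
  have hD : ∀ r ∈ Ioi (0 : ℝ), iteratedDeriv k (fun s => ut u s t) r =
      iteratedDeriv k f r + iteratedDeriv (k + 2) (fun s => u s t) r := by
    intro r hr
    have hn := isOpen_Ioi.mem_nhds hr
    have e : (fun s => ut u s t) =ᶠ[𝓝 r] fun s => f s + urr u s t := by
      filter_upwards [hn] with s hs using heq s hs
    rw [e.iteratedDeriv_eq k, iteratedDeriv_fun_add ((hf' r hr).contDiffAt hn)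
      ((h2 r hr).contDiffAt hn), iteratedDeriv_succ', iteratedDeriv_succ']
    rfl
  have key : ∀ x > 0, ∀ y, x ≤ y → ‖iteratedDeriv k (fun s => ut u s t) y -
      iteratedDeriv k (fun s => ut u s t) x‖ ≤ C' * (y - x) := by
    intro x hx y hxy
    have hsub : Icc x y ⊆ Ioi 0 := fun z hz => lt_of_lt_of_le hx hz.1
    obtain ⟨K, hK⟩ := (isCompact_Icc (a := x) (b := y)).exists_bound_of_continuousOn
      ((hf.continuousOn_iteratedDeriv_of_isOpen isOpen_Ioi le_rfl).mono hsub)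
    have hL1 : LipschitzOnWith K.toNNReal (iteratedDeriv k f) (Icc x y) :=
      (convex_Icc x y).lipschitzOnWith_of_nnnorm_hasDerivWithin_le
        (fun z hz => (hf.hasDerivAt_iteratedDeriv_of_isOpen isOpen_Ioi (Nat.lt_succ_self k)
          (hsub hz)).hasDerivWithinAt) fun z hz => by
        rw [← NNReal.coe_le_coe, coe_nnnorm]
        exact (hK z hz).trans (Real.le_coe_toNNReal K)
    have hL2 : LipschitzOnWith C.toNNReal (iteratedDeriv (k + 2) fun s => u s t) (Icc x y) :=
      LipschitzOnWith.of_dist_le_mul fun z hz w hw => by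
        rw [dist_eq_norm, Real.dist_eq]
        refine (hB.2.2 z (hsub hz) w (hsub hw)).trans ?_
        gcongr
        exact Real.le_coe_toNNReal C
    have hL : LipschitzOnWith (K.toNNReal + C.toNNReal)
        (iteratedDeriv k fun s => ut u s t) (Icc x y) := fun z hz w hw => by
      rw [hD z (hsub hz), hD w (hsub hw)]
      exact hL1.add hL2 hz hw
    refine norm_sub_le_of_lipschitzOnWith_of_norm_deriv_le hxy hL fun z _ => ?_
    rw [← iteratedDeriv_succ]
    exact hC' (k + 1) le_rfl z
  refine ⟨(hf'.add h2).congr heq, fun j hj x _ => hC' j (by omega) x, fun x hx y hy => ?_⟩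
  rcases le_total x y with hxy | hxy
  · rw [norm_sub_rev, abs_sub_comm, abs_of_nonneg (sub_nonneg.2 hxy)]
    exact key x hx y hxy
  · rw [abs_of_nonneg (sub_nonneg.2 hxy)]
    exact key y hy x hxy

end IsRadialSolution

/-- compactness. -/
theorem stmt12 {n d k : ℕ} (hn : 1 ≤ n) (hd : 2 ≤ d) (hk : 2 ≤ k)
    (V : Euc n → ℝ) (hV : ContDiff ℝ (k : ℕ∞) V) (hcoerc : HCoerc V)
    (u : ℝ → ℝ → Euc n) (hu : IsRadialSolution d V u)
    (hC1 : ∃ C : ℝ, ∀ t > (0:ℝ), ∀ j ≤ k + 1, ∀ r : ℝ,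
      ‖iteratedDeriv j (fun s => u s t) r‖ ≤ C)
    (hC2 : ∃ C : ℝ, ∀ t > (0:ℝ), ∀ j ≤ k - 1, ∀ r : ℝ,
      ‖iteratedDeriv j (fun s => ut u s t) r‖ ≤ C)
    (rp tp : ℕ → ℝ) (hrp0 : ∀ p, 0 ≤ rp p) (htp : ∀ p, 0 < tp p)
    (hrp : Tendsto rp atTop atTop) :
    ∃ σ : ℕ → ℕ, StrictMono σ ∧
      ∃ uinf vinf : ℝ → Euc n,
        ContDiff ℝ (k : ℕ∞) uinf ∧
        (∃ C : ℝ, ∀ j ≤ k, ∀ r : ℝ, ‖iteratedDeriv j uinf r‖ ≤ C) ∧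
        ContDiff ℝ ((k - 2 : ℕ) : ℕ∞) vinf ∧
        (∃ C : ℝ, ∀ j ≤ k - 2, ∀ r : ℝ, ‖iteratedDeriv j vinf r‖ ≤ C) ∧
        (∀ L > (0:ℝ), ∀ j ≤ k,
          TendstoUniformlyOn
            (fun p r => iteratedDeriv j (fun s => u (rp (σ p) + s) (tp (σ p))) r)
            (iteratedDeriv j uinf) atTop (Icc (-L) L)) ∧
        (∀ L > (0:ℝ), ∀ j ≤ k - 2,
          TendstoUniformlyOn
            (fun p r => iteratedDeriv j (fun s => ut u (rp (σ p) + s) (tp (σ p))) r)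
            (iteratedDeriv j vinf) atTop (Icc (-L) L)) ∧
        ∀ r : ℝ, vinf r = -gradient V (uinf r) + deriv (deriv uinf) r := by
  obtain ⟨l, rfl⟩ : ∃ l, k = l + 2 := ⟨k - 2, by omega⟩
  obtain ⟨C, hC⟩ := hC1
  obtain ⟨C', hC'⟩ := hC2
  have hV' : ContDiff ℝ (l + 2 : ℕ) V := hV
  have hB : ∀ p, BddLip (l + 2) C fun s => u s (tp p) := fun p => hu.bddLip hV' hC (htp p)
  have hB' : ∀ p, BddLip l C' fun s => ut u s (tp p) := fun p =>
    hu.bddLip_ut hV' (htp p) (hB p) (hC' (tp p) (htp p))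
  obtain ⟨σ, hσ, uinf, hcu, hbu, hlu⟩ := BddLip.exists_subseq_translate _ hB rp hrp
  obtain ⟨τ, hτ, vinf, hcv, hbv, hlv⟩ := BddLip.exists_subseq_translate _ (fun p => hB' (σ p))
    (fun p => rp (σ p)) (hrp.comp hσ.tendsto_atTop)
  have hlu' : ∀ L : ℝ, ∀ j ≤ l + 2, TendstoUniformlyOn
      (fun p r => iteratedDeriv j (fun s => u (rp (σ (τ p)) + s) (tp (σ (τ p)))) r)
      (iteratedDeriv j uinf) atTop (Icc (-L) L) := fun L j hj U hU =>
    hτ.tendsto_atTop.eventually (hlu L j hj U hU)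
  refine ⟨σ ∘ τ, hσ.comp hτ, uinf, vinf, hcu, ⟨C, hbu⟩, hcv, ⟨C', hbv⟩,
    fun L _ j hj => hlu' L j hj, fun L _ j hj => hlv L j hj, fun r => ?_⟩
  set ρ : ℕ → ℝ := fun p => rp (σ (τ p)) with hρdef
  have hρ : Tendsto (fun p => ρ p + r) atTop atTop :=
    tendsto_atTop_add_const_right _ _ (hrp.comp (hσ.comp hτ).tendsto_atTop)
  have hmem : r ∈ Icc (-|r|) |r| := abs_le.1 le_rfl
  have hlim : ∀ j ≤ l + 2, Tendsto
      (fun p => iteratedDeriv j (fun s => u s (tp (σ (τ p)))) (ρ p + r)) atTop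
      (𝓝 (iteratedDeriv j uinf r)) := by
    intro j hj
    refine ((hlu' |r| j hj).tendsto_at hmem).congr fun p => ?_
    exact congrFun (iteratedDeriv_comp_const_add j (fun s => u s (tp (σ (τ p)))) (ρ p)) r
  have l0 : Tendsto (fun p => u (ρ p + r) (tp (σ (τ p)))) atTop (𝓝 (uinf r)) := by
    simpa using hlim 0 (by omega)
  have l1 : Tendsto (fun p => ur u (ρ p + r) (tp (σ (τ p)))) atTop (𝓝 (deriv uinf r)) := by
    simpa only [iteratedDeriv_one, ur] using hlim 1 (by omega)
  have l2 : Tendsto (fun p => urr u (ρ p + r) (tp (σ (τ p)))) atTop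
      (𝓝 (deriv (deriv uinf) r)) := by
    have := hlim 2 (by omega)
    simp only [iteratedDeriv_succ, iteratedDeriv_zero] at this
    exact this
  have lv : Tendsto (fun p => ut u (ρ p + r) (tp (σ (τ p)))) atTop (𝓝 (vinf r)) := by
    simpa using (hlv |r| 0 (by omega)).tendsto_at hmem
  have lq : Tendsto (fun p => ((d : ℝ) - 1) / (ρ p + r)) atTop (𝓝 0) :=
    tendsto_const_nhds.div_atTop hρ
  have lg : Tendsto (fun p => gradient V (u (ρ p + r) (tp (σ (τ p))))) atTop
      (𝓝 (gradient V (uinf r))) :=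
    (hV'.gradient.continuous.tendsto _).comp l0
  have hsum := (lg.neg.add (lq.smul l1)).add l2
  rw [zero_smul, add_zero] at hsum
  refine tendsto_nhds_unique (lv.congr' ?_) hsum
  filter_upwards [hρ.eventually_gt_atTop 0] with p hp
  exact hu.pde _ hp _ (htp _)
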